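/- Let γ > 1, φ, ψ ∈ C¹_b(ℝ), μ = 1, and λ = 2. Then there exist constants ε₀ > 0 and C > 0 such that for every 0 < ε ≤ ε₀, the Cauchy problem u_t − v_x = 0, v_t + p(u)_x = −(2/(1+t)) v with initial data (u(0,x), v(0,x)) = (1 + εφ(x), εψ(x)) admits a C¹_b solution with u positive on [0, e^{C/ε}] × ℝ; i.e., the lifespan satisfies T* ≥ e^{C/ε}. -/

import Mathlib

noncomputable section
open Real Set

/-- Partial derivative with respect to time of a function of `(t, x)`. -/
def pdt (f : ℝ → ℝ → ℝ) (t x : ℝ) : ℝ := deriv (fun τ => f τ x) t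

/-- Partial derivative with respect to space of a function of `(t, x)`. -/
def pdx (f : ℝ → ℝ → ℝ) (t x : ℝ) : ℝ := deriv (fun ξ => f t ξ) x

/-- The strip `[0,T] × ℝ`. -/
def strip (T : ℝ) : Set (ℝ × ℝ) := Set.Icc 0 T ×ˢ (Set.univ : Set ℝ)

/-- The half-space `[0,∞) × ℝ`. -/
def stripInf : Set (ℝ × ℝ) := Set.Ici (0 : ℝ) ×ˢ (Set.univ : Set ℝ)

/-- The pressure `p(u) = u^(-γ)/γ`. -/
def pres (γ u : ℝ) : ℝ := u ^ (-γ) / γ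

/-- The sound speed `c(u) = u^(-(γ+1)/2)`. -/
def cspeed (γ u : ℝ) : ℝ := u ^ (-(γ + 1) / 2)

/-- The first Riemann invariant `r = v - (2/(γ-1)) u^(-(γ-1)/2) + 2/(γ-1)`. -/
def rInv (γ u v : ℝ) : ℝ := v - (2 / (γ - 1)) * u ^ (-(γ - 1) / 2) + 2 / (γ - 1)

/-- The second Riemann invariant `s = v + (2/(γ-1)) u^(-(γ-1)/2) - 2/(γ-1)`. -/
def sInv (γ u v : ℝ) : ℝ := v + (2 / (γ - 1)) * u ^ (-(γ - 1) / 2) - 2 / (γ - 1)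

/-- `(u,v)` solves the damped compressible Euler system on the set `S`. -/
def IsEulerOn (γ lam μ : ℝ) (u v : ℝ → ℝ → ℝ) (S : Set (ℝ × ℝ)) : Prop :=
  ∀ p ∈ S, pdt u p.1 p.2 - pdx v p.1 p.2 = 0 ∧
    pdt v p.1 p.2 + pdx (fun t x => pres γ (u t x)) p.1 p.2
      = -(lam / (1 + p.1) ^ μ) * v p.1 p.2

/-- `f` is `C¹` on `S ⊆ ℝ × ℝ`. -/
def IsC1On (f : ℝ → ℝ → ℝ) (S : Set (ℝ × ℝ)) : Prop :=
  ContDiffOn ℝ 1 (fun p : ℝ × ℝ => f p.1 p.2) S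

/-- `f` is `C²` on `S ⊆ ℝ × ℝ`. -/
def IsC2On (f : ℝ → ℝ → ℝ) (S : Set (ℝ × ℝ)) : Prop :=
  ContDiffOn ℝ 2 (fun p : ℝ × ℝ => f p.1 p.2) S

/-- `f` is `C¹_b` on `S ⊆ ℝ × ℝ`: `C¹` with `f` and its first partials bounded. -/
def IsC1bOn (f : ℝ → ℝ → ℝ) (S : Set (ℝ × ℝ)) : Prop :=
  IsC1On f S ∧ ∃ M : ℝ, ∀ p ∈ S, |f p.1 p.2| + |pdt f p.1 p.2| + |pdx f p.1 p.2| ≤ M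

/-- `f : ℝ → ℝ` is `C¹_b`. -/
def IsC1b (f : ℝ → ℝ) : Prop :=
  ContDiff ℝ 1 f ∧ ∃ M : ℝ, ∀ x, |f x| + |deriv f x| ≤ M

/-- The damping coefficient `λ/(2(1+t)^μ)`. -/
def damp (lam μ t : ℝ) : ℝ := lam / (2 * (1 + t) ^ μ)

/-- `A(t) = exp(∫₀ᵗ λ/(2(1+τ)^μ) dτ)`. -/
def Afun (lam μ t : ℝ) : ℝ := Real.exp (∫ τ in (0 : ℝ)..t, damp lam μ τ)

/-- `θ_γ(u)`. -/
def theta (γ u : ℝ) : ℝ :=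
  if γ = 3 then Real.log u else (4 / (3 - γ)) * (u ^ ((3 - γ) / 4) - 1)

open Function Filter Topology

/-- `F` has first partial derivatives `Q` (in the first variable) and `P` (in the second one) and
mixed second derivative `f`, all of them continuous. -/
structure HasMixedDeriv {E : Type*} [NormedAddCommGroup E] [NormedSpace ℝ E]
    (F Q P f : ℝ → ℝ → E) : Prop where
  deriv_left : ∀ a b, HasDerivAt (fun s => F s b) (Q a b) a
  deriv_right : ∀ a b, HasDerivAt (fun s => F a s) (P a b) b
  deriv_mixed : ∀ a b, HasDerivAt (fun s => P s b) (f a b) a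
  deriv_mixed' : ∀ a b, HasDerivAt (fun s => Q a s) (f a b) b
  cont_left : Continuous (uncurry Q)
  cont_right : Continuous (uncurry P)
  cont_mixed : Continuous (uncurry f)

theorem contDiff_one_of_continuous_partials {E : Type*} [NormedAddCommGroup E] [NormedSpace ℝ E]
    {F Q P : ℝ → ℝ → E}
    (hQ : ∀ a b, HasDerivAt (fun s => F s b) (Q a b) a)
    (hP : ∀ a b, HasDerivAt (fun s => F a s) (P a b) b)
    (hQc : Continuous (uncurry Q)) (hPc : Continuous (uncurry P)) :
    ContDiff ℝ 1 (uncurry F) ∧ ∀ z : ℝ × ℝ, HasStrictFDerivAt (uncurry F)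
      ((ContinuousLinearMap.toSpanSingleton ℝ (Q z.1 z.2)).coprod
        (ContinuousLinearMap.toSpanSingleton ℝ (P z.1 z.2))) z := by
  have hQ' : Continuous (uncurry fun a b => ContinuousLinearMap.toSpanSingleton ℝ (Q a b)) :=
    (ContinuousLinearMap.toSpanSingletonCLE (𝕜 := ℝ) (E := E)).continuous.comp hQc
  have hP' : Continuous (uncurry fun a b => ContinuousLinearMap.toSpanSingleton ℝ (P a b)) :=
    (ContinuousLinearMap.toSpanSingletonCLE (𝕜 := ℝ) (E := E)).continuous.comp hPc
  have key : ∀ z : ℝ × ℝ, HasStrictFDerivAt (uncurry F)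
      ((ContinuousLinearMap.toSpanSingleton ℝ (Q z.1 z.2)).coprod
        (ContinuousLinearMap.toSpanSingleton ℝ (P z.1 z.2))) z := fun z =>
    hasStrictFDerivAt_uncurry_coprod (𝕜 := ℝ)
      (f₁ := fun a b => ContinuousLinearMap.toSpanSingleton ℝ (Q a b))
      (f₂ := fun a b => ContinuousLinearMap.toSpanSingleton ℝ (P a b))
      (Eventually.of_forall fun v => (hQ v.1 v.2).hasFDerivAt)
      (Eventually.of_forall fun v => (hP v.1 v.2).hasFDerivAt) hQ'.continuousAt hP'.continuousAt
  refine ⟨contDiff_one_iff_hasFDerivAt.2 ⟨_, ?_, fun z => (key z).hasFDerivAt⟩, key⟩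
  refine ((hQ'.clm_comp (continuous_const (y := ContinuousLinearMap.fst ℝ ℝ ℝ))).add
    (hP'.clm_comp (continuous_const (y := ContinuousLinearMap.snd ℝ ℝ ℝ)))).congr fun z => ?_
  ext <;> simp [uncurry]

theorem HasMixedDeriv.hasStrictFDerivAt {E : Type*} [NormedAddCommGroup E] [NormedSpace ℝ E]
    {F Q P f : ℝ → ℝ → E} (h : HasMixedDeriv F Q P f) (z : ℝ × ℝ) :
    HasStrictFDerivAt (uncurry F)
      ((ContinuousLinearMap.toSpanSingleton ℝ (Q z.1 z.2)).coprod
        (ContinuousLinearMap.toSpanSingleton ℝ (P z.1 z.2))) z :=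
  (contDiff_one_of_continuous_partials h.deriv_left h.deriv_right h.cont_left h.cont_right).2 z

theorem HasMixedDeriv.contDiff {E : Type*} [NormedAddCommGroup E] [NormedSpace ℝ E]
    {F Q P f : ℝ → ℝ → E} (h : HasMixedDeriv F Q P f) : ContDiff ℝ 1 (uncurry F) :=
  (contDiff_one_of_continuous_partials h.deriv_left h.deriv_right h.cont_left h.cont_right).1

theorem hasDerivAt_diagonal {E : Type*} [NormedAddCommGroup E] [NormedSpace ℝ E]
    {F Q P f : ℝ → ℝ → E} (h : HasMixedDeriv F Q P f) (a : ℝ) :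
    HasDerivAt (fun s => F s s) (Q a a + P a a) a := by
  have h1 := (h.hasStrictFDerivAt (a, a)).hasFDerivAt.comp_hasDerivAt (f := fun s => (s, s)) a
    ((hasDerivAt_id a).prodMk (hasDerivAt_id a))
  simpa [comp_def] using h1

theorem HasMixedDeriv.clm {E E' : Type*} [NormedAddCommGroup E] [NormedSpace ℝ E]
    [NormedAddCommGroup E'] [NormedSpace ℝ E']
    {F Q P f : ℝ → ℝ → E} (h : HasMixedDeriv F Q P f) (L : E →L[ℝ] E') :
    HasMixedDeriv (fun a b => L (F a b)) (fun a b => L (Q a b)) (fun a b => L (P a b))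
      (fun a b => L (f a b)) where
  deriv_left a b := L.hasFDerivAt.comp_hasDerivAt a (h.deriv_left a b)
  deriv_right a b := L.hasFDerivAt.comp_hasDerivAt b (h.deriv_right a b)
  deriv_mixed a b := L.hasFDerivAt.comp_hasDerivAt a (h.deriv_mixed a b)
  deriv_mixed' a b := L.hasFDerivAt.comp_hasDerivAt b (h.deriv_mixed' a b)
  cont_left := L.continuous.comp h.cont_left
  cont_right := L.continuous.comp h.cont_right
  cont_mixed := L.continuous.comp h.cont_mixed

theorem HasMixedDeriv.sub {E : Type*} [NormedAddCommGroup E] [NormedSpace ℝ E]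
    {F Q P f F' Q' P' f' : ℝ → ℝ → E} (h : HasMixedDeriv F Q P f)
    (h' : HasMixedDeriv F' Q' P' f') : HasMixedDeriv (fun a b => F a b - F' a b)
      (fun a b => Q a b - Q' a b) (fun a b => P a b - P' a b) (fun a b => f a b - f' a b) where
  deriv_left a b := (h.deriv_left a b).sub (h'.deriv_left a b)
  deriv_right a b := (h.deriv_right a b).sub (h'.deriv_right a b)
  deriv_mixed a b := (h.deriv_mixed a b).sub (h'.deriv_mixed a b)
  deriv_mixed' a b := (h.deriv_mixed' a b).sub (h'.deriv_mixed' a b)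
  cont_left := h.cont_left.sub h'.cont_left
  cont_right := h.cont_right.sub h'.cont_right
  cont_mixed := h.cont_mixed.sub h'.cont_mixed

section DAlembert
variable {E : Type*} [NormedAddCommGroup E] [NormedSpace ℝ E] [CompleteSpace E]

theorem hasMixedDeriv_double_integral {f : ℝ → ℝ → E} (hf : Continuous (uncurry f)) :
    HasMixedDeriv (fun a b => ∫ s in (0 : ℝ)..b, ∫ r in (0 : ℝ)..a, f r s)
      (fun a b => ∫ s in (0 : ℝ)..b, f a s) (fun a b => ∫ r in (0 : ℝ)..a, f r b) f := by
  have hf' : Continuous (uncurry fun b a => f a b) := hf.comp continuous_swap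
  have hQc : Continuous (uncurry fun a b => ∫ s in (0 : ℝ)..b, f a s) :=
    intervalIntegral.continuous_parametric_primitive_of_continuous hf
  have hPc : Continuous (uncurry fun a b => ∫ r in (0 : ℝ)..a, f r b) :=
    (intervalIntegral.continuous_parametric_primitive_of_continuous hf').comp continuous_swap
  refine ⟨fun a b => ?_, fun a b => ?_, fun a b => ?_, fun a b => ?_, hQc, hPc, hf⟩
  · have hswap : (fun a' => ∫ s in (0 : ℝ)..b, ∫ r in (0 : ℝ)..a', f r s) =
        fun a' => ∫ r in (0 : ℝ)..a', ∫ s in (0 : ℝ)..b, f r s := by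
      funext a'
      refine MeasureTheory.intervalIntegral_intervalIntegral_swap (F := fun s r => f r s) ?_
      exact (hf'.continuousOn.integrableOn_compact (isCompact_uIcc.prod isCompact_uIcc)).mono_set
        (prod_mono uIoc_subset_uIcc uIoc_subset_uIcc)
    rw [hswap]
    exact ((hQc.comp (continuous_id.prodMk continuous_const) :
      Continuous fun r => ∫ s in (0 : ℝ)..b, f r s)).integral_hasStrictDerivAt 0 a |>.hasDerivAt
  · exact ((hPc.comp (continuous_const.prodMk continuous_id) :
      Continuous fun s => ∫ r in (0 : ℝ)..a, f r s)).integral_hasStrictDerivAt 0 b |>.hasDerivAt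
  · exact ((hf.comp (continuous_id.prodMk continuous_const) :
      Continuous fun r => f r b)).integral_hasStrictDerivAt 0 a |>.hasDerivAt
  · exact ((hf.comp (continuous_const.prodMk continuous_id) :
      Continuous fun s => f a s)).integral_hasStrictDerivAt 0 b |>.hasDerivAt

/-- Solution of `∂₁∂₂F = f` with Cauchy data on the diagonal. -/
theorem exists_hasMixedDeriv {f : ℝ → ℝ → E} (hf : Continuous (uncurry f)) {F₀ q p : ℝ → E}
    (hq : Continuous q) (hp : Continuous p) (hF₀ : ∀ s, HasDerivAt F₀ (q s + p s) s) :
    ∃ F Q P, HasMixedDeriv F Q P f ∧ (∀ s, F s s = F₀ s) ∧ (∀ s, Q s s = q s) ∧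
      ∀ s, P s s = p s := by
  have hJ := hasMixedDeriv_double_integral hf
  set J : ℝ → ℝ → E := fun a b => ∫ s in (0 : ℝ)..b, ∫ r in (0 : ℝ)..a, f r s
  set JQ : ℝ → ℝ → E := fun a b => ∫ s in (0 : ℝ)..b, f a s
  set JP : ℝ → ℝ → E := fun a b => ∫ r in (0 : ℝ)..a, f r b
  have hdiag : Continuous fun s : ℝ => (s, s) := by fun_prop
  have hQd : Continuous fun s => q s - JQ s s := hq.sub (hJ.cont_left.comp hdiag)
  have hPd : Continuous fun s => p s - JP s s := hp.sub (hJ.cont_right.comp hdiag)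
  have hA := fun a => (hQd.integral_hasStrictDerivAt 0 a).hasDerivAt
  have hB := fun a => (hPd.integral_hasStrictDerivAt 0 a).hasDerivAt
  refine ⟨fun a b => F₀ 0 + ((∫ s in (0 : ℝ)..a, (q s - JQ s s)) +
    (∫ s in (0 : ℝ)..b, (p s - JP s s)) + J a b),
    fun a b => q a - JQ a a + JQ a b, fun a b => p b - JP b b + JP a b,
    ⟨fun a b => ?_, fun a b => ?_, fun a b => ?_, fun a b => ?_, ?_, ?_, hf⟩, ?_, ?_, ?_⟩
  · exact (((hA a).add_const _).add (hJ.deriv_left a b)).const_add _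
  · exact (((hB b).const_add _).add (hJ.deriv_right a b)).const_add _
  · exact (hJ.deriv_mixed a b).const_add _
  · exact (hJ.deriv_mixed' a b).const_add _
  · exact (hQd.comp continuous_fst).add hJ.cont_left
  · exact (hPd.comp continuous_snd).add hJ.cont_right
  · intro s
    have hd : ∀ x, HasDerivAt (fun s => F₀ 0 + ((∫ r in (0 : ℝ)..s, (q r - JQ r r)) +
        (∫ r in (0 : ℝ)..s, (p r - JP r r)) + J s s) - F₀ s) 0 x := fun x => by
      refine (((((hA x).add (hB x)).add (hasDerivAt_diagonal hJ x)).const_add (F₀ 0)).sub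
        (hF₀ x)).congr_deriv ?_
      abel
    have := is_const_of_deriv_eq_zero (fun x => (hd x).differentiableAt)
      (fun x => (hd x).deriv) s 0
    simp only [J, intervalIntegral.integral_same, add_zero, sub_self] at this
    exact sub_eq_zero.1 this
  · intro s; simp
  · intro s; simp

theorem HasMixedDeriv.sub_eq_integral_right {F Q P f : ℝ → ℝ → E} (h : HasMixedDeriv F Q P f)
    (a b c : ℝ) : F a c - F a b = ∫ s in b..c, P a s :=
  (intervalIntegral.integral_eq_sub_of_hasDerivAt (fun s _ => h.deriv_right a s)
    ((h.cont_right.comp (continuous_const.prodMk continuous_id) :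
      Continuous fun s => P a s).intervalIntegrable _ _)).symm

theorem HasMixedDeriv.right_sub_eq_integral {F Q P f : ℝ → ℝ → E} (h : HasMixedDeriv F Q P f)
    (a b c : ℝ) : P b c - P a c = ∫ s in a..b, f s c :=
  (intervalIntegral.integral_eq_sub_of_hasDerivAt (fun s _ => h.deriv_mixed s c)
    ((h.cont_mixed.comp (continuous_id.prodMk continuous_const) :
      Continuous fun s => f s c).intervalIntegrable _ _)).symm

theorem HasMixedDeriv.left_sub_eq_integral {F Q P f : ℝ → ℝ → E} (h : HasMixedDeriv F Q P f)
    (a b c : ℝ) : Q a c - Q a b = ∫ s in b..c, f a s :=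
  (intervalIntegral.integral_eq_sub_of_hasDerivAt (fun s _ => h.deriv_mixed' a s)
    ((h.cont_mixed.comp (continuous_const.prodMk continuous_id) :
      Continuous fun s => f a s).intervalIntegrable _ _)).symm

end DAlembert

theorem norm_integral_le_cosh_left {E : Type*} [NormedAddCommGroup E] [NormedSpace ℝ E]
    {h : ℝ → E} {l d a b : ℝ} (hl : 0 < l) (hd : 0 ≤ d)
    (hh : ∀ s, ‖h s‖ ≤ cosh (l * (s - a)) * d) :
    ‖∫ s in a..b, h s‖ ≤ cosh (l * (b - a)) / l * d := by
  have hc : Continuous fun s => cosh (l * (s - a)) * d := by fun_prop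
  refine (intervalIntegral.norm_integral_le_abs_of_norm_le (Eventually.of_forall hh)
    (hc.intervalIntegrable _ _)).trans ?_
  have hder : ∀ s, HasDerivAt (fun s => sinh (l * (s - a)) / l * d) (cosh (l * (s - a)) * d) s := by
    intro s
    have h1 : HasDerivAt (fun s => l * (s - a)) l s := by
      simpa using ((hasDerivAt_id s).sub_const a).const_mul l
    refine ((h1.sinh.div_const l).mul_const d).congr_deriv ?_
    field_simp
  rw [intervalIntegral.integral_eq_sub_of_hasDerivAt (fun s _ => hder s)
    (hc.intervalIntegrable _ _)]
  simp only [sub_self, mul_zero, sinh_zero, zero_div, zero_mul, sub_zero]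
  rw [abs_mul, abs_div, abs_of_pos hl, abs_of_nonneg hd]
  gcongr
  rw [abs_le]
  have h1 := Real.cosh_sq (l * (b - a))
  have h2 := Real.cosh_pos (l * (b - a))
  constructor <;> nlinarith

theorem HasMixedDeriv.norm_le_cosh {E : Type*} [NormedAddCommGroup E] [NormedSpace ℝ E]
    [CompleteSpace E] {F Q P f : ℝ → ℝ → E} (h : HasMixedDeriv F Q P f) {l d : ℝ} (hl : 1 ≤ l)
    (hd : 0 ≤ d) (hF : ∀ s, F s s = 0) (hQ : ∀ s, Q s s = 0) (hP : ∀ s, P s s = 0)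
    (hf : ∀ a b, ‖f a b‖ ≤ cosh (l * (b - a)) * d) (a b : ℝ) :
    ‖(F a b, Q a b, P a b)‖ ≤ cosh (l * (b - a)) / l * d := by
  have hl0 : 0 < l := by linarith
  have hPb : ∀ a b, ‖P a b‖ ≤ cosh (l * (b - a)) / l * d := fun a b => by
    have h1 := h.right_sub_eq_integral b a b
    rw [hP, sub_zero] at h1
    rw [h1]
    have h2 : ∀ x y : ℝ, cosh (l * (x - y)) = cosh (l * (y - x)) := fun x y => by
      rw [← cosh_neg]; ring_nf
    rw [h2 b a]
    exact norm_integral_le_cosh_left hl0 hd fun s => by rw [h2 s b]; exact hf s b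
  have hQb : ‖Q a b‖ ≤ cosh (l * (b - a)) / l * d := by
    have h1 := h.left_sub_eq_integral a a b
    rw [hQ, sub_zero] at h1
    rw [h1]
    exact norm_integral_le_cosh_left hl0 hd fun s => hf a s
  have hFb : ‖F a b‖ ≤ cosh (l * (b - a)) / l * d := by
    have h1 := h.sub_eq_integral_right a a b
    rw [hF, sub_zero] at h1
    rw [h1]
    refine norm_integral_le_cosh_left hl0 hd fun s => (hPb a s).trans ?_
    gcongr
    exact div_le_self (Real.cosh_pos _).le hl
  simp only [Prod.norm_def, sup_le_iff]
  exact ⟨hFb, hQb, hPb a b⟩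

/-- Global solvability of `∂₁∂₂F = N(·, F, ∂₁F, ∂₂F)` for bounded and uniformly Lipschitz `N`, with
Cauchy data on the diagonal. -/
theorem exists_semilinear {E : Type*} [NormedAddCommGroup E] [NormedSpace ℝ E] [CompleteSpace E]
    {N : ℝ × ℝ → E × E × E → E} (hN : Continuous (uncurry N)) {B L : ℝ}
    (hB : ∀ z X, ‖N z X‖ ≤ B) (hL : ∀ z X Y, ‖N z X - N z Y‖ ≤ L * ‖X - Y‖) {F₀ q p : ℝ → E}
    (hq : Continuous q) (hp : Continuous p) (hF₀ : ∀ s, HasDerivAt F₀ (q s + p s) s) :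
    ∃ F Q P, HasMixedDeriv F Q P (fun a b => N (a, b) (F a b, Q a b, P a b)) ∧
      (∀ s, F s s = F₀ s) ∧ (∀ s, Q s s = q s) ∧ ∀ s, P s s = p s := by
  set l : ℝ := 2 * |L| + 1 with hl_def
  have hl : 1 ≤ l := by have := abs_nonneg L; linarith
  set w : ℝ × ℝ → ℝ := fun z => cosh (l * (z.2 - z.1)) with hw_def
  have hw : Continuous w := by fun_prop
  have hw0 : ∀ z, 0 < w z := fun z => Real.cosh_pos _
  have hw1 : ∀ z, 1 ≤ w z := fun z => Real.one_le_cosh _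
  have hf : ∀ g : BoundedContinuousFunction (ℝ × ℝ) E,
      Continuous (uncurry fun a b => w (a, b) • g (a, b)) := fun g => hw.smul g.continuous
  choose F Q P hM hF hQ hP using fun g => exists_hasMixedDeriv (hf g) hq hp hF₀
  have hcont : ∀ g, Continuous fun z : ℝ × ℝ => N z (F g z.1 z.2, Q g z.1 z.2, P g z.1 z.2) :=
    fun g => hN.comp (continuous_id.prodMk ((hM g).contDiff.continuous.prodMk
      ((hM g).cont_left.prodMk (hM g).cont_right)))
  let T : BoundedContinuousFunction (ℝ × ℝ) E → BoundedContinuousFunction (ℝ × ℝ) E := fun g =>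
    BoundedContinuousFunction.ofNormedAddCommGroup
      (fun z : ℝ × ℝ => (w z)⁻¹ • N z (F g z.1 z.2, Q g z.1 z.2, P g z.1 z.2))
      ((hw.inv₀ fun z => (hw0 z).ne').smul (hcont g)) B (fun z => by
        rw [norm_smul, norm_inv, Real.norm_of_nonneg (hw0 z).le]
        exact (mul_le_of_le_one_left (norm_nonneg _)
          (inv_le_one_of_one_le₀ (hw1 z))).trans (hB _ _))
  have hT_apply : ∀ g z, T g z = (w z)⁻¹ • N z (F g z.1 z.2, Q g z.1 z.2, P g z.1 z.2) :=
    fun _ _ => rfl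
  have hT : ContractingWith (1 / 2) T := by
    refine ⟨by norm_num, LipschitzWith.of_dist_le_mul fun g g' => ?_⟩
    refine (BoundedContinuousFunction.dist_le (by positivity)).2 fun z => ?_
    have hd := (((hM g).sub (hM g')).norm_le_cosh hl (dist_nonneg (x := g) (y := g'))
      (by simp [hF]) (by simp [hQ]) (by simp [hP]) (fun a b => by
        rw [← smul_sub, norm_smul, Real.norm_of_nonneg (hw0 _).le, ← dist_eq_norm]
        exact mul_le_mul_of_nonneg_left (BoundedContinuousFunction.dist_coe_le_dist _)
          (hw0 _).le) z.1 z.2)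
    have hLz := hL z (F g z.1 z.2, Q g z.1 z.2, P g z.1 z.2)
      (F g' z.1 z.2, Q g' z.1 z.2, P g' z.1 z.2)
    simp only [Prod.mk_sub_mk] at hLz
    have hwz : 0 < w z := hw0 z
    change ‖_‖ ≤ w z / l * _ at hd
    rw [dist_eq_norm, hT_apply, hT_apply, ← smul_sub, norm_smul, norm_inv,
      Real.norm_of_nonneg hwz.le, inv_mul_le_iff₀ hwz]
    refine hLz.trans ((mul_le_mul (le_abs_self L) hd (norm_nonneg _) (abs_nonneg L)).trans ?_)
    have h1 : |L| / l ≤ 1 / 2 := by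
      rw [div_le_div_iff₀ (by linarith) (by norm_num)]; linarith
    have h2 : 0 ≤ w z * dist g g' := by positivity
    calc |L| * (w z / l * dist g g') = |L| / l * (w z * dist g g') := by ring
      _ ≤ 1 / 2 * (w z * dist g g') := by gcongr
      _ = w z * (((1 / 2 : NNReal) : ℝ) * dist g g') := by push_cast; ring
  have hfix := hT.fixedPoint_isFixedPt
  set g := ContractingWith.fixedPoint T hT
  refine ⟨F g, Q g, P g, ?_, hF g, hQ g, hP g⟩
  convert hM g using 3 with a b
  have h1 : T g (a, b) = g (a, b) := by rw [hfix]
  rw [← h1, hT_apply, smul_inv_smul₀ (hw0 _).ne']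

/-- Truncation of `s` to the interval `[lo, hi]`. -/
def clamp (lo hi s : ℝ) : ℝ := max lo (min s hi)

theorem le_clamp (lo hi s : ℝ) : lo ≤ clamp lo hi s := le_max_left _ _

theorem clamp_le {lo hi : ℝ} (h : lo ≤ hi) (s : ℝ) : clamp lo hi s ≤ hi :=
  max_le h (min_le_right _ _)

theorem clamp_of_mem {lo hi s : ℝ} (h₁ : lo ≤ s) (h₂ : s ≤ hi) : clamp lo hi s = s := by
  rw [clamp, min_eq_left h₂, max_eq_right h₁]

theorem abs_clamp_le {k : ℝ} (hk : 0 ≤ k) (s : ℝ) : |clamp (-k) k s| ≤ k :=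
  abs_le.2 ⟨le_clamp _ _ _, clamp_le (by linarith) _⟩

theorem abs_clamp_sub_clamp_le (lo hi s s' : ℝ) :
    |clamp lo hi s - clamp lo hi s'| ≤ |s - s'| := by
  unfold clamp
  refine (abs_max_sub_max_le_max _ _ _ _).trans (max_le (by simp) ?_)
  exact (abs_min_sub_min_le_max _ _ _ _).trans (max_le le_rfl (by simp))

@[fun_prop]
theorem continuous_clamp (lo hi : ℝ) : Continuous (clamp lo hi) := by
  unfold clamp; fun_prop

section Lipschitz
variable {Y X : Type*} [NormedAddCommGroup X]

/-- Lipschitz in the second variable, uniformly in the first one. -/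
def UnifLip (f : Y → X → ℝ) : Prop :=
  ∃ L, 0 ≤ L ∧ ∀ y x₁ x₂, |f y x₁ - f y x₂| ≤ L * ‖x₁ - x₂‖

/-- Bounded, and Lipschitz in the second variable uniformly in the first one. -/
def BddLip (f : Y → X → ℝ) : Prop :=
  (∃ B, 0 ≤ B ∧ ∀ y x, |f y x| ≤ B) ∧ UnifLip f

theorem BddLip.const (c : ℝ) : BddLip (fun (_ : Y) (_ : X) => c) :=
  ⟨⟨|c|, abs_nonneg _, fun _ _ => le_rfl⟩, ⟨0, le_rfl, fun _ _ _ => by simp⟩⟩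

theorem UnifLip.sub {f g : Y → X → ℝ} (hf : UnifLip f) (hg : UnifLip g) :
    UnifLip fun y x => f y x - g y x := by
  obtain ⟨K, hK, hf⟩ := hf
  obtain ⟨L, hL, hg⟩ := hg
  refine ⟨K + L, by positivity, fun y x x' => ?_⟩
  have h : f y x - g y x - (f y x' - g y x') = (f y x - f y x') - (g y x - g y x') := by ring
  rw [h, add_mul]
  exact (abs_sub _ _).trans (add_le_add (hf y x x') (hg y x x'))

theorem UnifLip.clamp {f : Y → X → ℝ} (hf : UnifLip f) (lo hi : ℝ) :
    BddLip fun y x => clamp lo hi (f y x) := by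
  obtain ⟨L, hL, hf⟩ := hf
  refine ⟨⟨max |lo| |hi|, by positivity, fun y x => ?_⟩, L, hL, fun y x x' =>
    (abs_clamp_sub_clamp_le _ _ _ _).trans (hf y x x')⟩
  refine abs_le'.2 ⟨max_le ((le_abs_self lo).trans (le_max_left _ _)) ?_, ?_⟩
  · exact (min_le_right _ _).trans ((le_abs_self hi).trans (le_max_right _ _))
  · exact (neg_le_neg (le_clamp lo hi _)).trans ((neg_le_abs lo).trans (le_max_left _ _))

theorem BddLip.sub {f g : Y → X → ℝ} (hf : BddLip f) (hg : BddLip g) :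
    BddLip fun y x => f y x - g y x := by
  refine ⟨?_, hf.2.sub hg.2⟩
  obtain ⟨⟨B, hB, hf⟩, -⟩ := hf
  obtain ⟨⟨C, hC, hg⟩, -⟩ := hg
  exact ⟨B + C, by positivity, fun y x => (abs_sub _ _).trans (add_le_add (hf y x) (hg y x))⟩

theorem BddLip.mul {f g : Y → X → ℝ} (hf : BddLip f) (hg : BddLip g) :
    BddLip fun y x => f y x * g y x := by
  obtain ⟨⟨B, hB, hf⟩, K, hK, hf'⟩ := hf
  obtain ⟨⟨C, hC, hg⟩, L, hL, hg'⟩ := hg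
  refine ⟨⟨B * C, by positivity, fun y x => ?_⟩, B * L + K * C, by positivity, fun y x x' => ?_⟩
  · rw [abs_mul]
    exact mul_le_mul (hf y x) (hg y x) (abs_nonneg _) hB
  · have h : f y x * g y x - f y x' * g y x' =
        f y x * (g y x - g y x') + (f y x - f y x') * g y x' := by ring
    calc |f y x * g y x - f y x' * g y x'|
        ≤ |f y x| * |g y x - g y x'| + |f y x - f y x'| * |g y x'| := by
          rw [h, ← abs_mul, ← abs_mul]; exact abs_add_le _ _
      _ ≤ B * (L * ‖x - x'‖) + K * ‖x - x'‖ * C := by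
          gcongr
          exacts [hf y x, hg' y x x', hf' y x x', hg y x']
      _ = (B * L + K * C) * ‖x - x'‖ := by ring

theorem BddLip.add {f g : Y → X → ℝ} (hf : BddLip f) (hg : BddLip g) :
    BddLip fun y x => f y x + g y x := by
  simpa using hf.sub ((BddLip.const (-1)).mul hg)

theorem UnifLip.inv {f : Y → X → ℝ} (hf : UnifLip f) {m : ℝ} (hm : 0 < m)
    (hfm : ∀ y x, m ≤ f y x) : BddLip fun y x => (f y x)⁻¹ := by
  obtain ⟨L, hL, hf⟩ := hf
  have hpos : ∀ y x, 0 < f y x := fun y x => hm.trans_le (hfm y x)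
  refine ⟨⟨m⁻¹, by positivity, fun y x => ?_⟩, m⁻¹ * m⁻¹ * L, by positivity, fun y x x' => ?_⟩
  · rw [abs_of_pos (inv_pos.2 (hpos y x))]
    exact inv_anti₀ hm (hfm y x)
  · have h : (f y x)⁻¹ - (f y x')⁻¹ = (f y x)⁻¹ * (f y x')⁻¹ * (f y x' - f y x) := by
      have := (hpos y x).ne'
      have := (hpos y x').ne'
      field_simp
    rw [h, abs_mul, abs_of_pos (mul_pos (inv_pos.2 (hpos y x)) (inv_pos.2 (hpos y x'))),
      mul_assoc (m⁻¹ * m⁻¹), abs_sub_comm]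
    have h1 := inv_anti₀ hm (hfm y x)
    have h2 := inv_anti₀ hm (hfm y x')
    have h3 := inv_pos.2 (hpos y x')
    exact mul_le_mul (mul_le_mul h1 h2 h3.le (by positivity)) (hf y x x') (abs_nonneg _)
      (by positivity)

theorem UnifLip.max_left {f : Y → X → ℝ} (hf : UnifLip f) (g : Y → ℝ) :
    UnifLip fun y x => max (f y x) (g y) := by
  obtain ⟨L, hL, hf⟩ := hf
  refine ⟨L, hL, fun y x x' => ?_⟩
  exact (abs_max_sub_max_le_max _ _ _ _).trans (max_le (hf y x x') (by simp; positivity))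

theorem BddLip.prodMk {f g : Y → X → ℝ} (hf : BddLip f) (hg : BddLip g) :
    (∃ B, ∀ y x, ‖(f y x, g y x)‖ ≤ B) ∧
      ∃ L, ∀ y x x', ‖(f y x, g y x) - (f y x', g y x')‖ ≤ L * ‖x - x'‖ := by
  obtain ⟨⟨B, hB, hf⟩, K, hK, hf'⟩ := hf
  obtain ⟨⟨C, hC, hg⟩, L, hL, hg'⟩ := hg
  refine ⟨⟨max B C, fun y x => max_le_max (hf y x) (hg y x)⟩, max K L, fun y x x' => ?_⟩
  refine max_le ((hf' y x x').trans ?_) ((hg' y x x').trans ?_)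
  · gcongr; exact le_max_left _ _
  · gcongr; exact le_max_right _ _

end Lipschitz

theorem mul_le_sub_le_mul_of_hasDerivAt {f f' : ℝ → ℝ} {a b m M : ℝ} (hab : a ≤ b)
    (hf : ∀ s, HasDerivAt f (f' s) s) (hm : ∀ s ∈ Icc a b, m ≤ f' s)
    (hM : ∀ s ∈ Icc a b, f' s ≤ M) :
    m * (b - a) ≤ f b - f a ∧ f b - f a ≤ M * (b - a) := by
  rcases hab.eq_or_lt with rfl | hab
  · simp
  obtain ⟨s, hs, h⟩ := exists_hasDerivAt_eq_slope f f' hab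
    (fun x _ => (hf x).continuousAt.continuousWithinAt) (fun x _ => hf x)
  have h0 : 0 < b - a := sub_pos.2 hab
  have h1 : f b - f a = f' s * (b - a) := by rw [h]; field_simp
  rw [h1]
  have := hm s (Ioo_subset_Icc_self hs)
  have := hM s (Ioo_subset_Icc_self hs)
  constructor <;> gcongr

theorem abs_integral_le_arsinh {h : ℝ → ℝ} {C a b : ℝ} (hC : 0 ≤ C)
    (hh : ∀ s, |h s| ≤ C * (√(1 + (s - a) ^ 2))⁻¹) :
    |∫ s in a..b, h s| ≤ C * arsinh |b - a| := by
  have hder : ∀ s, HasDerivAt (fun s => C * arsinh (s - a)) (C * (√(1 + (s - a) ^ 2))⁻¹) s := by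
    intro s
    have h1 : HasDerivAt (fun s => s - a) 1 s := (hasDerivAt_id s).sub_const a
    simpa using ((hasDerivAt_arsinh (s - a)).comp s h1).const_mul C
  have hc : Continuous fun s => C * (√(1 + (s - a) ^ 2))⁻¹ :=
    continuous_const.mul (Continuous.inv₀ (by fun_prop) fun s => by positivity)
  have h1 := intervalIntegral.norm_integral_le_abs_of_norm_le (μ := MeasureTheory.volume)
    (Eventually.of_forall fun s => (Real.norm_eq_abs (h s)).trans_le (hh s))
    (hc.intervalIntegrable a b)
  rw [intervalIntegral.integral_eq_sub_of_hasDerivAt (fun s _ => hder s)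
    (hc.intervalIntegrable _ _)] at h1
  refine h1.trans (le_of_eq ?_)
  rw [sub_self, arsinh_zero, mul_zero, sub_zero, abs_mul, abs_of_nonneg hC]
  congr 1
  rcases le_total 0 (b - a) with h | h
  · rw [abs_of_nonneg h, abs_of_nonneg (arsinh_nonneg_iff.2 h)]
  · rw [abs_of_nonpos h, arsinh_neg, abs_of_nonpos (arsinh_nonpos_iff.2 h)]

section Truncated

/-- Truncated version of `1 + t`. -/
def truncTau (z : ℝ × ℝ) (X : (ℝ × ℝ) × (ℝ × ℝ) × (ℝ × ℝ)) : ℝ :=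
  max (1 + X.1.1) (√(1 + (z.2 - z.1) ^ 2) / 8)

/-- Truncated version of `U / (1 + t)`. -/
def truncEta (κ R : ℝ) (z : ℝ × ℝ) (X : (ℝ × ℝ) × (ℝ × ℝ) × (ℝ × ℝ)) : ℝ :=
  clamp (-κ) κ (clamp (-R) R X.1.2 * (truncTau z X)⁻¹)

/-- Truncated right-hand side of the equation for `∂₁∂₂ t`. -/
def truncRhs (γ κ R : ℝ) (z : ℝ × ℝ) (X : (ℝ × ℝ) × (ℝ × ℝ) × (ℝ × ℝ)) : ℝ :=
  (γ + 1) / 4 * (1 - (γ - 1) / 2 * truncEta κ R z X)⁻¹ * (truncTau z X)⁻¹ *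
    (clamp (-κ) κ X.2.1.2 * clamp (1 / 4) 1 X.2.2.1 +
      clamp (-κ) κ X.2.2.2 * clamp (-1) (-(1 / 4)) X.2.1.1 -
      2 * truncEta κ R z X * (clamp (-1) (-(1 / 4)) X.2.1.1 * clamp (1 / 4) 1 X.2.2.1))

theorem one_eighth_le_truncTau (z X) : 1 / 8 ≤ truncTau z X := by
  have : 1 ≤ √(1 + (z.2 - z.1) ^ 2) := Real.one_le_sqrt.2 (by nlinarith [sq_nonneg (z.2 - z.1)])
  exact le_max_of_le_right (by linarith)

theorem half_le_of_abs_le {γ κ e : ℝ} (hγ : 1 < γ) (hκ : (γ - 1) * κ ≤ 1) (he : |e| ≤ κ) :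
    1 / 2 ≤ 1 - (γ - 1) / 2 * e := by
  have := (abs_le.1 he).2
  nlinarith

theorem continuous_truncTau : Continuous (uncurry truncTau) := by
  unfold truncTau uncurry; fun_prop

theorem continuous_truncEta (κ R : ℝ) : Continuous (uncurry (truncEta κ R)) := by
  have h1 : Continuous fun p : (ℝ × ℝ) × _ => (truncTau p.1 p.2)⁻¹ :=
    continuous_truncTau.inv₀ fun p => by
      have := one_eighth_le_truncTau p.1 p.2
      simp only [uncurry]; linarith
  unfold truncEta uncurry; fun_prop

theorem continuous_truncRhs {γ κ : ℝ} (R : ℝ) (hγ : 1 < γ) (hκ0 : 0 ≤ κ)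
    (hκ : (γ - 1) * κ ≤ 1) : Continuous (uncurry (truncRhs γ κ R)) := by
  have h1 : Continuous fun p : (ℝ × ℝ) × _ => (truncTau p.1 p.2)⁻¹ :=
    continuous_truncTau.inv₀ fun p => by
      have := one_eighth_le_truncTau p.1 p.2
      simp only [uncurry]; linarith
  have h2 : Continuous fun p : (ℝ × ℝ) × _ => truncEta κ R p.1 p.2 := continuous_truncEta κ R
  have h3 : Continuous fun p : (ℝ × ℝ) × _ => (1 - (γ - 1) / 2 * truncEta κ R p.1 p.2)⁻¹ := by
    refine Continuous.inv₀ (by fun_prop) fun p => ?_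
    have : |truncEta κ R p.1 p.2| ≤ κ := abs_clamp_le hκ0 _
    linarith [half_le_of_abs_le hγ hκ this]
  unfold truncRhs uncurry; fun_prop

theorem bddLip_truncEta (κ R : ℝ) :
    BddLip (truncEta κ R) ∧ BddLip (fun z X => (truncTau z X)⁻¹) := by
  have h1 : UnifLip fun (_ : ℝ × ℝ) (X : (ℝ × ℝ) × (ℝ × ℝ) × (ℝ × ℝ)) => 1 + X.1.1 :=
    ⟨1, zero_le_one, fun _ X X' => by
      rw [add_sub_add_left_eq_sub, one_mul]
      exact (norm_fst_le (X - X').1).trans (norm_fst_le (X - X'))⟩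
  have h2 : UnifLip fun (_ : ℝ × ℝ) (X : (ℝ × ℝ) × (ℝ × ℝ) × (ℝ × ℝ)) => X.1.2 :=
    ⟨1, zero_le_one, fun _ X X' => by
      rw [one_mul]; exact (norm_snd_le (X - X').1).trans (norm_fst_le (X - X'))⟩
  have h3 : BddLip fun z X => (truncTau z X)⁻¹ :=
    (h1.max_left fun z => √(1 + (z.2 - z.1) ^ 2) / 8).inv (by norm_num) one_eighth_le_truncTau
  exact ⟨((h2.clamp _ _).mul h3).2.clamp _ _, h3⟩

theorem bddLip_truncRhs {γ κ : ℝ} (R : ℝ) (hγ : 1 < γ) (hκ0 : 0 ≤ κ) (hκ : (γ - 1) * κ ≤ 1) :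
    BddLip (truncRhs γ κ R) := by
  obtain ⟨hE, hT⟩ := bddLip_truncEta κ R
  have hp : ∀ f : (ℝ × ℝ) × (ℝ × ℝ) × (ℝ × ℝ) →L[ℝ] ℝ,
      UnifLip fun (_ : ℝ × ℝ) (X : (ℝ × ℝ) × (ℝ × ℝ) × (ℝ × ℝ)) => f X := fun f =>
    ⟨‖f‖, norm_nonneg _, fun _ X X' => by rw [← map_sub]; exact f.le_opNorm _⟩
  let f₀ := ContinuousLinearMap.snd ℝ (ℝ × ℝ) ((ℝ × ℝ) × (ℝ × ℝ))
  let f₁ := ContinuousLinearMap.fst ℝ (ℝ × ℝ) (ℝ × ℝ) ∘L f₀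
  let f₂ := ContinuousLinearMap.snd ℝ (ℝ × ℝ) (ℝ × ℝ) ∘L f₀
  have hQt := (hp (ContinuousLinearMap.fst ℝ ℝ ℝ ∘L f₁)).clamp (-1) (-(1 / 4))
  have hQU := (hp (ContinuousLinearMap.snd ℝ ℝ ℝ ∘L f₁)).clamp (-κ) κ
  have hPt := (hp (ContinuousLinearMap.fst ℝ ℝ ℝ ∘L f₂)).clamp (1 / 4) 1
  have hPU := (hp (ContinuousLinearMap.snd ℝ ℝ ℝ ∘L f₂)).clamp (-κ) κ
  have hy : BddLip fun z X => (1 - (γ - 1) / 2 * truncEta κ R z X)⁻¹ :=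
    ((BddLip.const 1).sub ((BddLip.const ((γ - 1) / 2)).mul hE)).2.inv (m := 1 / 2) (by norm_num)
      fun z X => half_le_of_abs_le hγ hκ (abs_clamp_le hκ0 _)
  exact (((BddLip.const ((γ + 1) / 4)).mul hy).mul hT).mul
    (((hQU.mul hPt).add (hPU.mul hQt)).sub (((BddLip.const 2).mul hE).mul (hQt.mul hPt)))

theorem abs_truncRhs_le {γ κ : ℝ} (R : ℝ) (hγ : 1 < γ) (hκ0 : 0 ≤ κ) (hκ : (γ - 1) * κ ≤ 1)
    (z X) : |truncRhs γ κ R z X| ≤ 16 * (γ + 1) * κ * (√(1 + (z.2 - z.1) ^ 2))⁻¹ := by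
  have hE : |truncEta κ R z X| ≤ κ := abs_clamp_le hκ0 _
  have hy := half_le_of_abs_le hγ hκ hE
  have hs : 0 < √(1 + (z.2 - z.1) ^ 2) := by positivity
  have hτ : (truncTau z X)⁻¹ ≤ 8 * (√(1 + (z.2 - z.1) ^ 2))⁻¹ := by
    have := inv_anti₀ (by positivity) (le_max_right (1 + X.1.1) (√(1 + (z.2 - z.1) ^ 2) / 8))
    rw [inv_div] at this
    rw [← div_eq_mul_inv]; exact this
  have hτ0 : 0 < truncTau z X := by linarith [one_eighth_le_truncTau z X]
  have hQU : |clamp (-κ) κ X.2.1.2| ≤ κ := abs_clamp_le hκ0 _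
  have hPU : |clamp (-κ) κ X.2.2.2| ≤ κ := abs_clamp_le hκ0 _
  have hPt : |clamp (1 / 4) 1 X.2.2.1| ≤ 1 :=
    abs_le.2 ⟨by linarith [le_clamp (1 / 4) 1 X.2.2.1], clamp_le (by norm_num) _⟩
  have hQt : |clamp (-1) (-(1 / 4)) X.2.1.1| ≤ 1 :=
    abs_le.2 ⟨le_clamp _ _ _,
      by linarith [clamp_le (lo := -1) (hi := -(1 / 4)) (by norm_num) X.2.1.1]⟩
  unfold truncRhs
  rw [abs_mul, abs_mul, abs_mul, abs_of_pos (inv_pos.2 hτ0),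
    abs_of_pos (inv_pos.2 (by linarith : 0 < 1 - (γ - 1) / 2 * truncEta κ R z X)),
    abs_of_pos (by linarith : 0 < (γ + 1) / 4)]
  have hyi : (1 - (γ - 1) / 2 * truncEta κ R z X)⁻¹ ≤ 2 := by
    have := inv_anti₀ (by norm_num) hy
    norm_num at this ⊢; exact this
  have h4 : |clamp (-κ) κ X.2.1.2 * clamp (1 / 4) 1 X.2.2.1 +
      clamp (-κ) κ X.2.2.2 * clamp (-1) (-(1 / 4)) X.2.1.1 -
      2 * truncEta κ R z X * (clamp (-1) (-(1 / 4)) X.2.1.1 * clamp (1 / 4) 1 X.2.2.1)| ≤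
        4 * κ := by
    refine (abs_sub _ _).trans ?_
    refine (add_le_add_left (abs_add_le _ _) _).trans ?_
    simp only [abs_mul, abs_two]
    have e1 := mul_le_mul hQU hPt (abs_nonneg _) hκ0
    have e2 := mul_le_mul hPU hQt (abs_nonneg _) hκ0
    have e3 := mul_le_mul hE (mul_le_mul hQt hPt (abs_nonneg _) zero_le_one)
      (by positivity) hκ0
    linarith
  calc _ ≤ (γ + 1) / 4 * 2 * (8 * (√(1 + (z.2 - z.1) ^ 2))⁻¹) * (4 * κ) := by
        have : 0 < γ + 1 := by linarith
        gcongr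
    _ = _ := by ring

end Truncated

/-- Global solution of the truncated characteristic system, which solves the original system on
`-1/4 < b - a < L`. Here `t` is the time and `U = (1 + t) η`. -/
theorem exists_time_riemann {γ κ L : ℝ} (hγ : 1 < γ) (hκ0 : 0 ≤ κ) (hκ : (γ - 1) * κ ≤ 1)
    (hL : 1 ≤ L) (hsmall : 16 * (γ + 1) * κ * arsinh L ≤ 1 / 8) {m η₀ qU pU : ℝ → ℝ}
    (hm : Continuous m) (hqU : Continuous qU) (hpU : Continuous pU)
    (hη₀ : ∀ s, HasDerivAt η₀ (qU s + pU s) s) (hm1 : ∀ s, 3 / 8 ≤ m s) (hm2 : ∀ s, m s ≤ 3 / 4)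
    (hη₀' : ∀ s, |η₀ s| ≤ κ / 8) (hqU' : ∀ s, |qU s| ≤ κ / 8) (hpU' : ∀ s, |pU s| ≤ κ / 8) :
    ∃ t tq tp tf U Uq Up Uf : ℝ → ℝ → ℝ, HasMixedDeriv t tq tp tf ∧ HasMixedDeriv U Uq Up Uf ∧
      (∀ s, t s s = 0 ∧ tq s s = -m s ∧ tp s s = m s) ∧
      (∀ s, U s s = η₀ s ∧ Uq s s = qU s ∧ Up s s = pU s) ∧
      ∀ a b, -(1 / 4) < b - a → b - a < L →
        (1 / 4 ≤ tp a b ∧ tp a b ≤ 1) ∧ (-1 ≤ tq a b ∧ tq a b ≤ -(1 / 4)) ∧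
        |Uq a b| ≤ κ / 4 ∧ |Up a b| ≤ κ / 4 ∧ 3 / 4 ≤ 1 + t a b ∧ t a b ≤ L ∧
        |U a b| ≤ κ * (1 + t a b) ∧
        tf a b = (γ + 1) / 4 * (1 - (γ - 1) / 2 * (U a b / (1 + t a b)))⁻¹ * (1 + t a b)⁻¹ *
          (Uq a b * tp a b + Up a b * tq a b - 2 * (U a b / (1 + t a b)) * (tq a b * tp a b)) ∧
        Uf a b = U a b / (1 + t a b) * tf a b := by
  set R := κ * (1 + L)
  set K := 16 * (γ + 1) * κ with hK_def
  have hK : 0 ≤ K := by have : 0 < γ + 1 := by linarith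
                        positivity
  have hE := (bddLip_truncEta κ R).1
  have hT := bddLip_truncRhs R hγ hκ0 hκ
  obtain ⟨⟨B, hB⟩, M, hM⟩ := hT.prodMk (hE.mul hT)
  have hcT := continuous_truncRhs R hγ hκ0 hκ
  obtain ⟨F, Q, P, h, hF, hQ, hP⟩ := exists_semilinear
    (N := fun z X => (truncRhs γ κ R z X, truncEta κ R z X * truncRhs γ κ R z X))
    (hcT.prodMk ((continuous_truncEta κ R).mul hcT)) hB hM
    (F₀ := fun s => (0, η₀ s)) (q := fun s => (-m s, qU s)) (p := fun s => (m s, pU s))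
    (hm.neg.prodMk hqU) (hm.prodMk hpU)
    (fun s => by simpa using (hasDerivAt_const s (0 : ℝ)).prodMk (hη₀ s))
  have ht := h.clm (ContinuousLinearMap.fst ℝ ℝ ℝ)
  have hU := h.clm (ContinuousLinearMap.snd ℝ ℝ ℝ)
  simp only [ContinuousLinearMap.coe_fst', ContinuousLinearMap.coe_snd'] at ht hU
  set G : ℝ → ℝ → (ℝ × ℝ) × (ℝ × ℝ) × (ℝ × ℝ) := fun a b => (F a b, Q a b, P a b)
  have htf : ∀ a b, |truncRhs γ κ R (a, b) (G a b)| ≤ K * (√(1 + (b - a) ^ 2))⁻¹ := fun a b =>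
    abs_truncRhs_le R hγ hκ0 hκ (a, b) (G a b)
  have htf' : ∀ a b, |truncRhs γ κ R (a, b) (G a b)| ≤ K * (√(1 + (a - b) ^ 2))⁻¹ := fun a b => by
    rw [show a - b = -(b - a) by ring, neg_sq]; exact htf a b
  have hUf : ∀ a b, |truncEta κ R (a, b) (G a b) * truncRhs γ κ R (a, b) (G a b)| ≤
      κ * (K * (√(1 + (b - a) ^ 2))⁻¹) := fun a b => by
    rw [abs_mul]
    exact mul_le_mul (abs_clamp_le hκ0 _) (htf a b) (abs_nonneg _) hκ0
  have hUf' : ∀ a b, |truncEta κ R (a, b) (G a b) * truncRhs γ κ R (a, b) (G a b)| ≤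
      κ * K * (√(1 + (a - b) ^ 2))⁻¹ := fun a b => by
    rw [show a - b = -(b - a) by ring, neg_sq, mul_assoc]; exact hUf a b
  have hars : ∀ d, |d| ≤ L → arsinh |d| ≤ arsinh L := fun d hd => arsinh_le_arsinh.2 hd
  have htp : ∀ a b, |b - a| ≤ L → |(P a b).1 - m b| ≤ 1 / 8 := fun a b hab => by
    have h1 := ht.right_sub_eq_integral b a b
    rw [hP] at h1
    simp only at h1
    rw [h1]
    refine (abs_integral_le_arsinh hK fun s => htf' s b).trans ?_
    rw [abs_sub_comm]
    exact (mul_le_mul_of_nonneg_left (hars _ hab) hK).trans hsmall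
  have htq : ∀ a b, |b - a| ≤ L → |(Q a b).1 + m a| ≤ 1 / 8 := fun a b hab => by
    have h1 := ht.left_sub_eq_integral a a b
    rw [hQ] at h1
    simp only [sub_neg_eq_add] at h1
    rw [h1]
    refine (abs_integral_le_arsinh hK fun s => htf a s).trans ?_
    exact (mul_le_mul_of_nonneg_left (hars _ hab) hK).trans hsmall
  have hκK : ∀ d, |d| ≤ L → κ * K * arsinh |d| ≤ κ / 8 := fun d hd => by
    have := mul_le_mul_of_nonneg_left ((mul_le_mul_of_nonneg_left (hars _ hd) hK).trans hsmall) hκ0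
    linarith
  have hUp : ∀ a b, |b - a| ≤ L → |(P a b).2| ≤ κ / 4 := fun a b hab => by
    have h1 := hU.right_sub_eq_integral b a b
    rw [hP] at h1
    simp only at h1
    have h2 := (abs_integral_le_arsinh (by positivity) fun s => hUf' s b).trans
      (hκK (a - b) (by rwa [abs_sub_comm]))
    rw [← h1] at h2
    have := hpU' b
    rw [abs_le] at *
    constructor <;> linarith
  have hUq : ∀ a b, |b - a| ≤ L → |(Q a b).2| ≤ κ / 4 := fun a b hab => by
    have h1 := hU.left_sub_eq_integral a a b
    rw [hQ] at h1
    simp only at h1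
    have h2 := (abs_integral_le_arsinh (by positivity) fun s =>
      (hUf a s).trans_eq (mul_assoc _ _ _).symm).trans (hκK (b - a) hab)
    rw [← h1] at h2
    have := hqU' a
    rw [abs_le] at *
    constructor <;> linarith
  have htp' : ∀ a b, |b - a| ≤ L → 1 / 4 ≤ (P a b).1 ∧ (P a b).1 ≤ 1 := fun a b hab => by
    have := abs_le.1 (htp a b hab)
    have := hm1 b
    have := hm2 b
    constructor <;> linarith
  have htq' : ∀ a b, |b - a| ≤ L → -1 ≤ (Q a b).1 ∧ (Q a b).1 ≤ -(1 / 4) := fun a b hab => by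
    have := abs_le.1 (htq a b hab)
    have := hm1 a
    have := hm2 a
    constructor <;> linarith
  refine ⟨_, _, _, _, _, _, _, _, ht, hU, fun s => by simp [hF, hQ, hP],
    fun s => by simp [hF, hQ, hP], fun a b h1 h2 => ?_⟩
  have hab : |b - a| ≤ L := abs_le.2 ⟨by linarith, h2.le⟩
  have hFa : F a a = (0, η₀ a) := hF a
  have key : |b - a| / 4 ≤ 5 / 16 + (F a b).1 ∧ -(1 / 4) ≤ (F a b).1 ∧ (F a b).1 ≤ L ∧
      |(F a b).2| ≤ κ / 8 + κ / 4 * |b - a| := by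
    rcases le_total a b with hle | hle
    · have hin : ∀ s ∈ Icc a b, |s - a| ≤ L := fun s hs => by
        rw [abs_of_nonneg (by linarith [hs.1])]; linarith [hs.2]
      have h3 := mul_le_sub_le_mul_of_hasDerivAt hle (fun s => ht.deriv_right a s)
        (fun s hs => (htp' a s (hin s hs)).1) (fun s hs => (htp' a s (hin s hs)).2)
      have h4 := mul_le_sub_le_mul_of_hasDerivAt hle (fun s => hU.deriv_right a s)
        (fun s hs => (abs_le.1 (hUp a s (hin s hs))).1)
        (fun s hs => (abs_le.1 (hUp a s (hin s hs))).2)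
      simp only [hFa] at h3 h4
      have := abs_le.1 (hη₀' a)
      rw [abs_of_nonneg (by linarith : 0 ≤ b - a), abs_le]
      refine ⟨?_, ?_, ?_, ?_, ?_⟩ <;> linarith
    · have hin : ∀ s ∈ Icc b a, |s - a| ≤ L := fun s hs => by
        rw [abs_of_nonpos (by linarith [hs.2])]; linarith [hs.1]
      have h3 := mul_le_sub_le_mul_of_hasDerivAt hle (fun s => ht.deriv_right a s)
        (fun s hs => (htp' a s (hin s hs)).1) (fun s hs => (htp' a s (hin s hs)).2)
      have h4 := mul_le_sub_le_mul_of_hasDerivAt hle (fun s => hU.deriv_right a s)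
        (fun s hs => (abs_le.1 (hUp a s (hin s hs))).1)
        (fun s hs => (abs_le.1 (hUp a s (hin s hs))).2)
      simp only [hFa] at h3 h4
      have := abs_le.1 (hη₀' a)
      rw [abs_of_nonpos (by linarith : b - a ≤ 0), abs_le]
      refine ⟨?_, ?_, ?_, ?_, ?_⟩ <;> linarith
  obtain ⟨k1, k2, k2', k3⟩ := key
  have hUR : |(F a b).2| ≤ R := k3.trans (by
    have := mul_le_mul_of_nonneg_left hab hκ0
    have : R = κ + κ * L := by simp only [R]; ring
    have : 0 ≤ κ * L := by positivity
    linarith)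
  have hUτ : |(F a b).2| ≤ κ * (1 + (F a b).1) := by
    refine k3.trans ?_
    have : 1 / 8 + 1 / 4 * |b - a| ≤ 1 + (F a b).1 := by linarith
    have := mul_le_mul_of_nonneg_left this hκ0
    linarith
  have hτ0 : 0 < 1 + (F a b).1 := by linarith
  have hτ : truncTau (a, b) (G a b) = 1 + (F a b).1 := by
    refine max_eq_left ?_
    have h3 : √(1 + (b - a) ^ 2) ≤ 1 + |b - a| := by
      rw [Real.sqrt_le_left (by positivity)]
      nlinarith [sq_abs (b - a), abs_nonneg (b - a)]
    change √(1 + (b - a) ^ 2) / 8 ≤ 1 + (F a b).1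
    linarith
  have hη : truncEta κ R (a, b) (G a b) = (F a b).2 / (1 + (F a b).1) := by
    unfold truncEta
    rw [hτ, clamp_of_mem (abs_le.1 hUR).1 (abs_le.1 hUR).2, ← div_eq_mul_inv]
    have : |(F a b).2 / (1 + (F a b).1)| ≤ κ := by
      rwa [abs_div, abs_of_pos hτ0, div_le_iff₀ hτ0]
    exact clamp_of_mem (abs_le.1 this).1 (abs_le.1 this).2
  have hp := abs_le.1 (hUp a b hab)
  have hq := abs_le.1 (hUq a b hab)
  refine ⟨htp' a b hab, htq' a b hab, hUq a b hab, hUp a b hab, by linarith, k2', hUτ, ?_, ?_⟩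
  · unfold truncRhs
    rw [hη, hτ]
    change _ * (clamp (-κ) κ (Q a b).2 * clamp (1 / 4) 1 (P a b).1 +
      clamp (-κ) κ (P a b).2 * clamp (-1) (-(1 / 4)) (Q a b).1 -
      2 * _ * (clamp (-1) (-(1 / 4)) (Q a b).1 * clamp (1 / 4) 1 (P a b).1)) = _
    rw [clamp_of_mem (by linarith) (by linarith), clamp_of_mem (htp' a b hab).1 (htp' a b hab).2,
      clamp_of_mem (by linarith) (by linarith), clamp_of_mem (htq' a b hab).1 (htq' a b hab).2]
  · rw [← hη]

theorem HasMixedDeriv.right_eq {F Q P f g : ℝ → ℝ → ℝ} {l L : ℝ} (hl : l < 0) (hL : 0 < L)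
    (h : HasMixedDeriv F Q P f)
    (hg : ∀ a b, l < b - a → b - a < L → HasDerivAt (fun s => g s b) (f a b) a)
    (h0 : ∀ s, P s s = g s s) {a b : ℝ} (h₁ : l < b - a) (h₂ : b - a < L) : P a b = g a b := by
  have hd : ∀ s ∈ Ioo (b - L) (b - l), HasDerivAt (fun s => P s b - g s b) 0 s := fun s hs =>
    ((h.deriv_mixed s b).sub (hg s b (by linarith [hs.2]) (by linarith [hs.1]))).congr_deriv
      (sub_self _)
  have := isOpen_Ioo.is_const_of_deriv_eq_zero isPreconnected_Ioo
    (fun s hs => (hd s hs).differentiableAt.differentiableWithinAt) (fun s hs => (hd s hs).deriv)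
    (x := a) (y := b) ⟨by linarith, by linarith⟩ ⟨by linarith, by linarith⟩
  rw [h0, sub_self] at this
  exact sub_eq_zero.1 this

theorem HasMixedDeriv.left_eq {F Q P f g : ℝ → ℝ → ℝ} {l L : ℝ} (hl : l < 0) (hL : 0 < L)
    (h : HasMixedDeriv F Q P f)
    (hg : ∀ a b, l < b - a → b - a < L → HasDerivAt (fun s => g a s) (f a b) b)
    (h0 : ∀ s, Q s s = g s s) {a b : ℝ} (h₁ : l < b - a) (h₂ : b - a < L) : Q a b = g a b := by
  have hd : ∀ s ∈ Ioo (a + l) (a + L), HasDerivAt (fun s => Q a s - g a s) 0 s := fun s hs =>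
    ((h.deriv_mixed' a s).sub (hg a s (by linarith [hs.1]) (by linarith [hs.2]))).congr_deriv
      (sub_self _)
  have := isOpen_Ioo.is_const_of_deriv_eq_zero isPreconnected_Ioo
    (fun s hs => (hd s hs).differentiableAt.differentiableWithinAt) (fun s hs => (hd s hs).deriv)
    (x := b) (y := a) ⟨by linarith, by linarith⟩ ⟨by linarith, by linarith⟩
  rw [h0, sub_self] at this
  exact sub_eq_zero.1 this

/-- The sound speed as a function of `η = (2/(γ-1)) (1 - u^(-(γ-1)/2))`. -/
def soundOf (γ e : ℝ) : ℝ := (1 - (γ - 1) / 2 * e) ^ ((γ + 1) / (γ - 1))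

/-- The specific volume `u` as a function of `η = (2/(γ-1)) (1 - u^(-(γ-1)/2))`. -/
def volumeOf (γ e : ℝ) : ℝ := (1 - (γ - 1) / 2 * e) ^ (-2 / (γ - 1))

section StateFunctions
variable {γ e : ℝ}

theorem soundOf_pos (hy : 0 < 1 - (γ - 1) / 2 * e) : 0 < soundOf γ e := rpow_pos_of_pos hy _

theorem volumeOf_pos (hy : 0 < 1 - (γ - 1) / 2 * e) : 0 < volumeOf γ e := rpow_pos_of_pos hy _

theorem cspeed_volumeOf (hγ : 1 < γ) (hy : 0 < 1 - (γ - 1) / 2 * e) :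
    cspeed γ (volumeOf γ e) = soundOf γ e := by
  have : γ - 1 ≠ 0 := by linarith
  unfold cspeed volumeOf soundOf
  rw [← rpow_mul hy.le]
  congr 1
  field_simp

theorem hasDerivAt_soundOf (hγ : 1 < γ) (hy : 0 < 1 - (γ - 1) / 2 * e) :
    HasDerivAt (soundOf γ)
      (-((γ + 1) / 2) * (soundOf γ e * (1 - (γ - 1) / 2 * e)⁻¹)) e := by
  have : γ - 1 ≠ 0 := by linarith
  have h1 : HasDerivAt (fun e => 1 - (γ - 1) / 2 * e) (-((γ - 1) / 2)) e := by
    simpa using ((hasDerivAt_id e).const_mul ((γ - 1) / 2)).const_sub 1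
  refine (h1.rpow_const (p := (γ + 1) / (γ - 1)) (Or.inl hy.ne')).congr_deriv ?_
  rw [rpow_sub_one hy.ne']
  unfold soundOf
  field_simp

theorem hasDerivAt_volumeOf (hγ : 1 < γ) (hy : 0 < 1 - (γ - 1) / 2 * e) :
    HasDerivAt (volumeOf γ) (soundOf γ e)⁻¹ e := by
  have : γ - 1 ≠ 0 := by linarith
  have h1 : HasDerivAt (fun e => 1 - (γ - 1) / 2 * e) (-((γ - 1) / 2)) e := by
    simpa using ((hasDerivAt_id e).const_mul ((γ - 1) / 2)).const_sub 1
  refine (h1.rpow_const (p := -2 / (γ - 1)) (Or.inl hy.ne')).congr_deriv ?_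
  unfold soundOf
  rw [← rpow_neg hy.le, show -((γ + 1) / (γ - 1)) = -2 / (γ - 1) - 1 by field_simp; ring]
  field_simp

end StateFunctions

/-- The domain of the characteristic coordinates; the diagonal corresponds to `t = 0`. -/
def charStrip (L : ℝ) : Set (ℝ × ℝ) := {z | -(1 / 4) < z.2 - z.1 ∧ z.2 - z.1 < L}

/-- The system in characteristic coordinates: time `t`, position `x` and the unknowns `u`, `v` as
functions on `charStrip L`. -/
structure IsCharSol (γ L : ℝ) (t tq tp x u uq up v : ℝ → ℝ → ℝ) : Prop where
  contDiff_t : ContDiff ℝ 1 (uncurry t)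
  contDiff_x : ContDiff ℝ 1 (uncurry x)
  contDiffAt_u : ∀ a b, (a, b) ∈ charStrip L → ContDiffAt ℝ 1 (uncurry u) (a, b)
  contDiffAt_v : ∀ a b, (a, b) ∈ charStrip L → ContDiffAt ℝ 1 (uncurry v) (a, b)
  t_left : ∀ a b, HasDerivAt (fun s => t s b) (tq a b) a
  t_right : ∀ a b, HasDerivAt (fun s => t a s) (tp a b) b
  x_left : ∀ a b, (a, b) ∈ charStrip L →
    HasDerivAt (fun s => x s b) (-(cspeed γ (u a b) * tq a b)) a
  x_right : ∀ a b, (a, b) ∈ charStrip L →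
    HasDerivAt (fun s => x a s) (cspeed γ (u a b) * tp a b) b
  u_left : ∀ a b, (a, b) ∈ charStrip L → HasDerivAt (fun s => u s b) (uq a b) a
  u_right : ∀ a b, (a, b) ∈ charStrip L → HasDerivAt (fun s => u a s) (up a b) b
  v_left : ∀ a b, (a, b) ∈ charStrip L → HasDerivAt (fun s => v s b)
    (-(cspeed γ (u a b) * uq a b) - 2 * v a b / (1 + t a b) * tq a b) a
  v_right : ∀ a b, (a, b) ∈ charStrip L → HasDerivAt (fun s => v a s)
    (cspeed γ (u a b) * up a b - 2 * v a b / (1 + t a b) * tp a b) b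
  tq_mem : ∀ a b, (a, b) ∈ charStrip L → tq a b ∈ Icc (-1) (-(1 / 4))
  tp_mem : ∀ a b, (a, b) ∈ charStrip L → tp a b ∈ Icc (1 / 4) 1
  t_ge : ∀ a b, (a, b) ∈ charStrip L → 3 / 4 ≤ 1 + t a b
  u_pos : ∀ a b, (a, b) ∈ charStrip L → 0 < u a b
  bdd : ∃ M, ∀ a b, (a, b) ∈ charStrip L → |u a b| ≤ M ∧ |v a b| ≤ M ∧ |uq a b| ≤ M ∧
    |up a b| ≤ M ∧ cspeed γ (u a b) ≤ M ∧ (cspeed γ (u a b))⁻¹ ≤ M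

theorem isOpen_charStrip (L : ℝ) : IsOpen (charStrip L) :=
  (isOpen_lt (continuous_const (y := -(1 / 4 : ℝ))) (continuous_snd.sub continuous_fst)).inter
    (isOpen_lt (continuous_snd.sub continuous_fst) (continuous_const (y := L)))

theorem exists_rpow_bound (p : ℝ) : ∃ M, 0 ≤ M ∧ ∀ y ∈ Icc (1 / 2 : ℝ) (3 / 2), |y ^ p| ≤ M := by
  obtain ⟨M, hM⟩ := isCompact_Icc.exists_bound_of_continuousOn (s := Icc (1 / 2 : ℝ) (3 / 2))
    (f := fun y => y ^ p) fun y hy =>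
      (continuousAt_rpow_const y p (Or.inl (by linarith [hy.1]))).continuousWithinAt
  exact ⟨M, (norm_nonneg _).trans (hM 1 ⟨by norm_num, by norm_num⟩), hM⟩

theorem exists_isCharSol {γ κ L : ℝ} (hγ : 1 < γ) (hκ0 : 0 ≤ κ) (hκ : (γ - 1) * κ ≤ 1)
    (hL : 1 ≤ L) (hsmall : 16 * (γ + 1) * κ * arsinh L ≤ 1 / 8) {η₀ e₁ v₀ w : ℝ → ℝ}
    (he₁ : Continuous e₁) (hw : Continuous w)
    (hη₀ : ∀ s, HasDerivAt η₀ (e₁ s) s) (hv₀ : ∀ s, HasDerivAt v₀ (w s) s)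
    (hη₀' : ∀ s, |η₀ s| ≤ κ / 32) (he₁' : ∀ s, |e₁ s| ≤ κ / 32) (hv₀' : ∀ s, |v₀ s| ≤ κ)
    (hw' : ∀ s, |w s| ≤ κ / 32)
    (hc : ∀ s, soundOf γ (η₀ s) ∈ Icc (2 / 3) (4 / 3)) :
    ∃ t tq tp x u uq up v : ℝ → ℝ → ℝ, IsCharSol γ L t tq tp x u uq up v ∧
      ∀ s, t s s = 0 ∧ x s s = s ∧ u s s = volumeOf γ (η₀ s) ∧ v s s = v₀ s := by
  have hy₀ : ∀ s, 0 < 1 - (γ - 1) / 2 * η₀ s := fun s => by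
    linarith [half_le_of_abs_le hγ hκ ((hη₀' s).trans (by linarith))]
  have hη₀c : Continuous η₀ := continuous_iff_continuousAt.2 fun s => (hη₀ s).continuousAt
  set m : ℝ → ℝ := fun s => (2 * soundOf γ (η₀ s))⁻¹ with hm_def
  have hmc : Continuous m := by
    refine Continuous.inv₀ (continuous_const.mul (continuous_iff_continuousAt.2 fun s =>
      ((hasDerivAt_soundOf hγ (hy₀ s)).comp s (hη₀ s)).continuousAt)) fun s => ?_
    have := soundOf_pos (hy₀ s)
    positivity
  have hm1 : ∀ s, 3 / 8 ≤ m s := fun s => by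
    have := inv_anti₀ (mul_pos two_pos (soundOf_pos (hy₀ s)))
      (show 2 * soundOf γ (η₀ s) ≤ 8 / 3 by linarith [(hc s).2])
    norm_num at this ⊢; simpa [m] using this
  have hm2 : ∀ s, m s ≤ 3 / 4 := fun s => by
    have := inv_anti₀ (by norm_num) (show 4 / 3 ≤ 2 * soundOf γ (η₀ s) by linarith [(hc s).1])
    norm_num at this ⊢; simpa [m] using this
  have hcm : ∀ s, soundOf γ (η₀ s) * m s = 1 / 2 := fun s => by
    have := soundOf_pos (hy₀ s)
    simp only [m]; field_simp
  set pU : ℝ → ℝ := fun s => (w s + e₁ s) / 2 + η₀ s * m s with hpU_def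
  have hpUc : Continuous pU := by fun_prop
  have hηm : ∀ s, |η₀ s * m s| ≤ κ / 32 := fun s => by
    rw [abs_mul, abs_of_nonneg (by linarith [hm1 s] : 0 ≤ m s)]
    have := mul_le_mul (hη₀' s) ((hm2 s).trans (by norm_num : (3 / 4 : ℝ) ≤ 1))
      (by linarith [hm1 s]) (by linarith)
    linarith
  have hpU' : ∀ s, |pU s| ≤ κ / 16 := fun s => by
    have h1 := abs_le.1 (hηm s)
    have h2 := abs_le.1 (hw' s)
    have h3 := abs_le.1 (he₁' s)
    rw [abs_le]
    simp only [pU]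
    constructor <;> linarith
  obtain ⟨t, tq, tp, tf, U, Uq, Up, Uf, ht, hU, htd, hUd, hD⟩ :=
    exists_time_riemann hγ hκ0 hκ hL hsmall hmc (qU := fun s => e₁ s - pU s) (pU := pU)
      (he₁.sub hpUc) hpUc (fun s => by simpa using hη₀ s) hm1 hm2
      (fun s => (hη₀' s).trans (by linarith)) (fun s => by
        have h1 := abs_le.1 (hpU' s)
        have h3 := abs_le.1 (he₁' s)
        rw [abs_le]; constructor <;> linarith) (fun s => (hpU' s).trans (by linarith))
  have htc : Continuous (uncurry t) := ht.contDiff.continuous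
  have hUc : Continuous (uncurry U) := hU.contDiff.continuous
  set e : ℝ → ℝ → ℝ := fun a b => clamp (-κ) κ (U a b * (max (1 + t a b) (1 / 2))⁻¹) with he_def
  have hτc : Continuous fun z : ℝ × ℝ => (max (1 + t z.1 z.2) (1 / 2))⁻¹ := by
    have : Continuous fun z : ℝ × ℝ => max (1 + t z.1 z.2) (1 / 2) :=
      (continuous_const.add htc).max continuous_const
    exact this.inv₀ fun z => ne_of_gt (lt_max_of_lt_right (by norm_num))
  have hec : Continuous (uncurry e) := (continuous_clamp _ _).comp (hUc.mul hτc)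
  have he : ∀ a b, |e a b| ≤ κ := fun a b => abs_clamp_le hκ0 _
  have hy : ∀ a b, 1 / 2 ≤ 1 - (γ - 1) / 2 * e a b := fun a b => half_le_of_abs_le hγ hκ (he a b)
  have hy0 : ∀ a b, 0 < 1 - (γ - 1) / 2 * e a b := fun a b => by linarith [hy a b]
  have hed : ∀ a b, (a, b) ∈ charStrip L → e a b = U a b / (1 + t a b) := fun a b hab => by
    obtain ⟨-, -, -, -, h1, -, h2, -⟩ := hD a b hab.1 hab.2
    have h0 : 0 < 1 + t a b := by linarith
    simp only [e]
    rw [max_eq_left (by linarith), ← div_eq_mul_inv]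
    have : |U a b / (1 + t a b)| ≤ κ := by rwa [abs_div, abs_of_pos h0, div_le_iff₀ h0]
    exact clamp_of_mem (abs_le.1 this).1 (abs_le.1 this).2
  have hopen := isOpen_charStrip L
  have heL : ∀ a b, (a, b) ∈ charStrip L →
      HasDerivAt (fun s => e s b) ((Uq a b - e a b * tq a b) / (1 + t a b)) a := fun a b hab => by
    have h0 : 1 + t a b ≠ 0 := by linarith [(hD a b hab.1 hab.2).2.2.2.2.1]
    have h1 := (hU.deriv_left a b).div ((ht.deriv_left a b).const_add 1) h0
    refine (h1.congr_of_eventuallyEq ?_).congr_deriv ?_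
    · have : ∀ᶠ s in 𝓝 a, (s, b) ∈ charStrip L :=
        (hopen.preimage (by fun_prop : Continuous fun s : ℝ => (s, b))).mem_nhds hab
      exact this.mono fun s hs => hed s b hs
    · rw [hed a b hab]; field_simp
  have heR : ∀ a b, (a, b) ∈ charStrip L →
      HasDerivAt (fun s => e a s) ((Up a b - e a b * tp a b) / (1 + t a b)) b := fun a b hab => by
    have h0 : 1 + t a b ≠ 0 := by linarith [(hD a b hab.1 hab.2).2.2.2.2.1]
    have h1 := (hU.deriv_right a b).div ((ht.deriv_right a b).const_add 1) h0
    refine (h1.congr_of_eventuallyEq ?_).congr_deriv ?_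
    · have : ∀ᶠ s in 𝓝 b, (a, s) ∈ charStrip L :=
        (hopen.preimage (by fun_prop : Continuous fun s : ℝ => (a, s))).mem_nhds hab
      exact this.mono fun s hs => hed a s hs
    · rw [hed a b hab]; field_simp
  have hcc : Continuous fun z : ℝ × ℝ => soundOf γ (e z.1 z.2) :=
    continuous_iff_continuousAt.2 fun z => ContinuousAt.comp (f := fun z : ℝ × ℝ => e z.1 z.2)
      (hasDerivAt_soundOf hγ (hy0 z.1 z.2)).continuousAt hec.continuousAt
  have hyc : Continuous fun z : ℝ × ℝ => (1 - (γ - 1) / 2 * e z.1 z.2)⁻¹ :=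
    (continuous_const.sub (continuous_const.mul hec)).inv₀ fun z => (hy0 z.1 z.2).ne'
  set xf : ℝ → ℝ → ℝ := fun a b => -((γ + 1) / 4) * (soundOf γ (e a b) *
    (1 - (γ - 1) / 2 * e a b)⁻¹) * (max (1 + t a b) (1 / 2))⁻¹ *
      (Uq a b * tp a b - Up a b * tq a b) with hxf_def
  have hxfc : Continuous (uncurry xf) :=
    ((continuous_const.mul (hcc.mul hyc)).mul hτc).mul
      ((hU.cont_left.mul ht.cont_right).sub (hU.cont_right.mul ht.cont_left))
  obtain ⟨x, xq, xp, hx, hxd, hxqd, hxpd⟩ := exists_hasMixedDeriv hxfc (F₀ := id)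
    (q := fun _ => 1 / 2) (p := fun _ => 1 / 2) continuous_const continuous_const
    (fun s => by norm_num; exact hasDerivAt_id s)
  set Vf : ℝ → ℝ → ℝ := fun a b => tq a b * Up a b - tp a b * Uq a b with hVf_def
  have hVfc : Continuous (uncurry Vf) :=
    (ht.cont_left.mul hU.cont_right).sub (ht.cont_right.mul hU.cont_left)
  obtain ⟨V, Vq, Vp, hV, hVd, hVqd, hVpd⟩ := exists_hasMixedDeriv hVfc (F₀ := v₀)
    (q := fun s => (w s - e₁ s) / 2) (p := fun s => (w s + e₁ s) / 2) (by fun_prop) (by fun_prop)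
    (fun s => (hv₀ s).congr_deriv (by ring))
  have htf : ∀ a b, (a, b) ∈ charStrip L → soundOf γ (e a b) * tf a b = (γ + 1) / 4 *
      (soundOf γ (e a b) * (1 - (γ - 1) / 2 * e a b)⁻¹) * (1 + t a b)⁻¹ *
      (Uq a b * tp a b + Up a b * tq a b - 2 * e a b * (tq a b * tp a b)) := fun a b hab => by
    rw [(hD a b hab.1 hab.2).2.2.2.2.2.2.2.1, hed a b hab]; ring
  have hUf : ∀ a b, (a, b) ∈ charStrip L → (1 + t a b) * Uf a b = U a b * tf a b :=
    fun a b hab => by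
    obtain ⟨-, -, -, -, h1, -, -, -, h2⟩ := hD a b hab.1 hab.2
    have h0 : 1 + t a b ≠ 0 := by linarith
    rw [h2]; field_simp
  have hmax : ∀ a b, (a, b) ∈ charStrip L → max (1 + t a b) (1 / 2) = 1 + t a b :=
    fun a b hab => max_eq_left (by linarith [(hD a b hab.1 hab.2).2.2.2.2.1])
  have hL0 : 0 < L := by linarith
  have hdiag : ∀ s, (s, s) ∈ charStrip L := fun s => ⟨by norm_num, by simpa⟩
  have hes : ∀ s, e s s = η₀ s := fun s => by
    rw [hed s s (hdiag s), (hUd s).1, (htd s).1]; simp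
  have hxp : ∀ a b, (a, b) ∈ charStrip L → xp a b = soundOf γ (e a b) * tp a b := fun a b hab => by
    refine hx.right_eq (g := fun a b => soundOf γ (e a b) * tp a b) (l := -(1 / 4)) (by norm_num)
      hL0 (fun a b h1 h2 => ?_) (fun s => ?_) hab.1 hab.2
    · have hab' : (a, b) ∈ charStrip L := ⟨h1, h2⟩
      refine (((hasDerivAt_soundOf hγ (hy0 a b)).comp a (heL a b hab')).mul
        (ht.deriv_mixed a b)).congr_deriv ?_
      simp only [comp_apply, htf a b hab', hxf_def, hmax a b hab']
      ring
    · rw [hxpd, hes, (htd s).2.2, hcm]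
  have hxq : ∀ a b, (a, b) ∈ charStrip L → xq a b = -(soundOf γ (e a b) * tq a b) :=
    fun a b hab => by
    refine hx.left_eq (g := fun a b => -(soundOf γ (e a b) * tq a b)) (l := -(1 / 4)) (by norm_num)
      hL0 (fun a b h1 h2 => ?_) (fun s => ?_) hab.1 hab.2
    · have hab' : (a, b) ∈ charStrip L := ⟨h1, h2⟩
      refine (((hasDerivAt_soundOf hγ (hy0 a b)).comp b (heR a b hab')).mul
        (ht.deriv_mixed' a b)).neg.congr_deriv ?_
      simp only [comp_apply, htf a b hab', hxf_def, hmax a b hab']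
      ring
    · rw [hxqd, hes, (htd s).2.1, mul_neg, neg_neg, hcm]
  have hVp : ∀ a b, (a, b) ∈ charStrip L → Vp a b = (1 + t a b) * Up a b - U a b * tp a b :=
    fun a b hab => by
    refine hV.right_eq (g := fun a b => (1 + t a b) * Up a b - U a b * tp a b) (l := -(1 / 4))
      (by norm_num) hL0 (fun a b h1 h2 => ?_) (fun s => ?_) hab.1 hab.2
    · refine ((((ht.deriv_left a b).const_add 1).mul (hU.deriv_mixed a b)).sub
        ((hU.deriv_left a b).mul (ht.deriv_mixed a b))).congr_deriv ?_
      rw [hUf a b ⟨h1, h2⟩]; ring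
    · rw [hVpd, (htd s).1, (htd s).2.2, (hUd s).1, (hUd s).2.2]; simp only [pU]; ring
  have hVq : ∀ a b, (a, b) ∈ charStrip L → Vq a b = U a b * tq a b - (1 + t a b) * Uq a b :=
    fun a b hab => by
    refine hV.left_eq (g := fun a b => U a b * tq a b - (1 + t a b) * Uq a b) (l := -(1 / 4))
      (by norm_num) hL0 (fun a b h1 h2 => ?_) (fun s => ?_) hab.1 hab.2
    · refine (((hU.deriv_right a b).mul (ht.deriv_mixed' a b)).sub
        (((ht.deriv_right a b).const_add 1).mul (hU.deriv_mixed' a b))).congr_deriv ?_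
      rw [hUf a b ⟨h1, h2⟩]; ring
    · rw [hVqd, (htd s).1, (htd s).2.1, (hUd s).1, (hUd s).2.1]; simp only [pU]; ring
  have hcs : ∀ a b, cspeed γ (volumeOf γ (e a b)) = soundOf γ (e a b) := fun a b =>
    cspeed_volumeOf hγ (hy0 a b)
  have ht0 : ∀ a b, (a, b) ∈ charStrip L → 0 < 1 + t a b := fun a b hab => by
    linarith [(hD a b hab.1 hab.2).2.2.2.2.1]
  refine ⟨t, tq, tp, x, fun a b => volumeOf γ (e a b),
    fun a b => (soundOf γ (e a b))⁻¹ * ((Uq a b - e a b * tq a b) / (1 + t a b)),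
    fun a b => (soundOf γ (e a b))⁻¹ * ((Up a b - e a b * tp a b) / (1 + t a b)),
    fun a b => V a b / (1 + t a b) ^ 2,
    ⟨ht.contDiff, hx.contDiff, fun a b hab => ?_, fun a b hab => ?_, ht.deriv_left, ht.deriv_right,
      fun a b hab => ?_, fun a b hab => ?_, fun a b hab => ?_, fun a b hab => ?_, fun a b hab => ?_,
      fun a b hab => ?_, fun a b hab => (hD a b hab.1 hab.2).2.1,
      fun a b hab => (hD a b hab.1 hab.2).1, fun a b hab => (hD a b hab.1 hab.2).2.2.2.2.1,
      fun a b hab => volumeOf_pos (hy0 a b), ?_⟩, fun s => ⟨(htd s).1, hxd s, ?_, ?_⟩⟩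
  · have h0 := ht0 a b hab
    have h1 : ContDiffAt ℝ 1 (uncurry e) (a, b) := by
      have h2 : ContDiffAt ℝ 1 (fun z : ℝ × ℝ => U z.1 z.2 / (1 + t z.1 z.2)) (a, b) :=
        hU.contDiff.contDiffAt.div (contDiffAt_const.add ht.contDiff.contDiffAt) h0.ne'
      refine h2.congr_of_eventuallyEq ?_
      filter_upwards [hopen.mem_nhds hab] with z hz using hed z.1 z.2 hz
    exact (contDiffAt_const.sub (contDiffAt_const.mul h1)).rpow_const_of_ne (hy0 a b).ne'
  · exact hV.contDiff.contDiffAt.div ((contDiffAt_const.add ht.contDiff.contDiffAt).pow 2)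
      (pow_ne_zero 2 (ht0 a b hab).ne')
  · simp only [hcs]
    exact (hx.deriv_left a b).congr_deriv (hxq a b hab)
  · simp only [hcs]
    exact (hx.deriv_right a b).congr_deriv (hxp a b hab)
  · exact (hasDerivAt_volumeOf hγ (hy0 a b)).comp a (heL a b hab)
  · exact (hasDerivAt_volumeOf hγ (hy0 a b)).comp b (heR a b hab)
  · have h0 := ht0 a b hab
    have hs := soundOf_pos (hy0 a b)
    refine ((hV.deriv_left a b).div (((ht.deriv_left a b).const_add 1).pow 2)
      (pow_ne_zero 2 h0.ne')).congr_deriv ?_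
    simp only [hcs, Pi.pow_apply]
    rw [hVq a b hab, mul_inv_cancel_left₀ hs.ne', hed a b hab]
    field_simp
    ring
  · have h0 := ht0 a b hab
    have hs := soundOf_pos (hy0 a b)
    refine ((hV.deriv_right a b).div (((ht.deriv_right a b).const_add 1).pow 2)
      (pow_ne_zero 2 h0.ne')).congr_deriv ?_
    simp only [hcs, Pi.pow_apply]
    rw [hVp a b hab, mul_inv_cancel_left₀ hs.ne', hed a b hab]
    field_simp
    ring
  · obtain ⟨M₁, hM₁, h₁⟩ := exists_rpow_bound (-2 / (γ - 1))
    obtain ⟨M₂, hM₂, h₂⟩ := exists_rpow_bound ((γ + 1) / (γ - 1))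
    obtain ⟨M₃, hM₃, h₃⟩ := exists_rpow_bound (-((γ + 1) / (γ - 1)))
    have hyI : ∀ a b, 1 - (γ - 1) / 2 * e a b ∈ Icc (1 / 2 : ℝ) (3 / 2) := fun a b =>
      ⟨hy a b, by have := (abs_le.1 (he a b)).1; nlinarith⟩
    have hci : ∀ a b, (soundOf γ (e a b))⁻¹ ≤ M₃ := fun a b => by
      unfold soundOf
      rw [← rpow_neg (hy0 a b).le]
      exact (le_abs_self _).trans (h₃ _ (hyI a b))
    have hquot : ∀ a b r q, (a, b) ∈ charStrip L → |r| ≤ κ / 4 → |q| ≤ 1 →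
        |(soundOf γ (e a b))⁻¹ * ((r - e a b * q) / (1 + t a b))| ≤ M₃ * (2 * κ) := by
      intro a b r q hab hr hq
      have h0 := ht0 a b hab
      have hs := soundOf_pos (hy0 a b)
      have h4 := (hD a b hab.1 hab.2).2.2.2.2.1
      have h5 : |r - e a b * q| ≤ κ / 4 + κ * 1 := (abs_sub _ _).trans (add_le_add hr
        (by rw [abs_mul]; exact mul_le_mul (he a b) hq (abs_nonneg _) hκ0))
      rw [abs_mul, abs_div, abs_of_pos h0, abs_of_pos (inv_pos.2 hs)]
      refine mul_le_mul (hci a b) ?_ (by positivity) hM₃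
      rw [div_le_iff₀ h0]
      nlinarith
    have hVb : ∀ a b, (a, b) ∈ charStrip L → |V a b| ≤ κ + 2 * κ * (1 + L) * L := by
      intro a b hab
      have hseg : ∀ s ∈ uIoc a b, (a, s) ∈ charStrip L := fun s hs => by
        obtain ⟨h1, h2⟩ := hab
        have h3 := uIoc_subset_uIcc hs
        rw [mem_uIcc] at h3
        simp only at h1 h2
        constructor <;> simp only <;> rcases h3 with h3 | h3 <;> linarith [h3.1, h3.2]
      have h6 := intervalIntegral.norm_integral_le_of_norm_le_const (f := fun s => Vp a s)
        (C := 2 * κ * (1 + L)) (a := a) (b := b) fun s hs => by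
          have hs' := hseg s hs
          obtain ⟨h1, h2, h3, h4, h5, h6, h7, -⟩ := hD a s hs'.1 hs'.2
          have h0 := ht0 a s hs'
          rw [hVp a s hs', Real.norm_eq_abs]
          refine (abs_sub _ _).trans ?_
          rw [abs_mul, abs_mul, abs_of_pos h0, abs_of_pos (by linarith : 0 < tp a s)]
          have e1 := mul_le_mul_of_nonneg_left h4 h0.le
          have e2 := mul_le_mul h7 h1.2 (by linarith) (by positivity)
          have e3 := mul_le_mul_of_nonneg_left h6 hκ0
          nlinarith
      rw [← hV.sub_eq_integral_right a a b, hVd, Real.norm_eq_abs] at h6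
      have h7 : |b - a| ≤ L := abs_le.2 ⟨by linarith [hab.1], hab.2.le⟩
      have h8 := mul_le_mul_of_nonneg_left h7 (by positivity : 0 ≤ 2 * κ * (1 + L))
      have h9 := abs_add_le (V a b - v₀ a) (v₀ a)
      rw [sub_add_cancel] at h9
      linarith [hv₀' a]
    refine ⟨M₁ + M₂ + M₃ + M₃ * (2 * κ) + 2 * (κ + 2 * κ * (1 + L) * L), fun a b hab => ?_⟩
    have hM₄ : 0 ≤ M₃ * (2 * κ) := by positivity
    have hM₅ : 0 ≤ κ + 2 * κ * (1 + L) * L := by positivity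
    obtain ⟨g1, g2, g3, g4, g5, -⟩ := hD a b hab.1 hab.2
    simp only [hcs]
    refine ⟨(h₁ _ (hyI a b)).trans (by linarith), ?_,
      (hquot a b _ _ hab g3 (abs_le.2 ⟨by linarith, by linarith⟩)).trans (by linarith),
      (hquot a b _ _ hab g4 (abs_le.2 ⟨by linarith, by linarith⟩)).trans (by linarith),
      ((le_abs_self _).trans (h₂ _ (hyI a b))).trans (by linarith), (hci a b).trans (by linarith)⟩
    rw [abs_div, abs_of_pos (pow_pos (ht0 a b hab) 2), div_le_iff₀ (pow_pos (ht0 a b hab) 2)]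
    have hsq : 1 / 2 ≤ (1 + t a b) ^ 2 := by nlinarith
    refine (hVb a b hab).trans ?_
    generalize κ + 2 * κ * (1 + L) * L = W at hM₅ ⊢
    have := mul_le_mul (show 2 * W ≤ M₁ + M₂ + M₃ + M₃ * (2 * κ) + 2 * W by linarith) hsq
      (by norm_num) (by positivity)
    linarith
  · simp only [hes]
  · simp only [hVd, (htd s).1]; simp

theorem contDiffAt_invFunOn {E F : Type*} [NormedAddCommGroup E] [NormedSpace ℝ E]
    [CompleteSpace E] [Nonempty E] [NormedAddCommGroup F] [NormedSpace ℝ F] {f : E → F} {s : Set E}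
    {f' : E ≃L[ℝ] F} {a : E} (hs : IsOpen s) (hinj : InjOn f s) (ha : a ∈ s)
    (hf : ContDiffAt ℝ 1 f a) (hf' : HasFDerivAt f (f' : E →L[ℝ] F) a) :
    ContDiffAt ℝ 1 (invFunOn f s) (f a) := by
  have hstrict := hf.hasStrictFDerivAt' hf' one_ne_zero
  have hloc := hf.to_localInverse hf' one_ne_zero
  have hval : hf.localInverse hf' one_ne_zero (f a) = a :=
    hf.localInverse_apply_image hf' one_ne_zero
  refine hloc.congr_of_eventuallyEq ?_
  have hmem : ∀ᶠ y in 𝓝 (f a), hf.localInverse hf' one_ne_zero y ∈ s :=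
    hloc.continuousAt.eventually (by rw [hval]; exact hs.mem_nhds ha)
  filter_upwards [hmem, hstrict.eventually_right_inverse] with y hy hy'
  change f (hf.localInverse hf' one_ne_zero y) = y at hy'
  have h1 : ∃ z ∈ s, f z = y := ⟨_, hy, hy'⟩
  exact hinj (invFunOn_mem h1) hy ((invFunOn_eq h1).trans hy'.symm)

theorem hasDerivAt_along_curve {f : ℝ → ℝ → ℝ} {f' : ℝ × ℝ →L[ℝ] ℝ} {p q : ℝ → ℝ} {s p' q' : ℝ}
    (hp : HasDerivAt p p' s) (hq : HasDerivAt q q' s)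
    (hf : HasFDerivAt (uncurry f) f' (p s, q s)) :
    HasDerivAt (fun s => f (p s) (q s)) (f' (p', q')) s :=
  HasFDerivAt.comp_hasDerivAt (l := uncurry f) (f := fun s => (p s, q s)) s hf (hp.prodMk hq)

theorem hasFDerivAt_uncurry {f : ℝ → ℝ → ℝ} {a b fa fb : ℝ}
    (hf : DifferentiableAt ℝ (uncurry f) (a, b)) (ha : HasDerivAt (fun s => f s b) fa a)
    (hb : HasDerivAt (fun s => f a s) fb b) :
    HasFDerivAt (uncurry f)
      (fa • ContinuousLinearMap.fst ℝ ℝ ℝ + fb • ContinuousLinearMap.snd ℝ ℝ ℝ) (a, b) := by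
  have h := hf.hasFDerivAt
  have h1 : HasDerivAt (fun s => f s b) (fderiv ℝ (uncurry f) (a, b) (1, 0)) a :=
    hasDerivAt_along_curve (hasDerivAt_id' a) (hasDerivAt_const a b) h
  have h2 : HasDerivAt (fun s => f a s) (fderiv ℝ (uncurry f) (a, b) (0, 1)) b :=
    hasDerivAt_along_curve (hasDerivAt_const b a) (hasDerivAt_id' b) h
  rw [ha.unique h1, hb.unique h2]
  convert h using 1
  ext <;> simp

/-- The invertible linear map with matrix `!![p, q; r, s]`. -/
def linearEquivOfDet (p q r s : ℝ) (h : p * s - q * r ≠ 0) : (ℝ × ℝ) ≃L[ℝ] (ℝ × ℝ) :=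
  ContinuousLinearEquiv.equivOfInverse
    ((p • ContinuousLinearMap.fst ℝ ℝ ℝ + q • ContinuousLinearMap.snd ℝ ℝ ℝ).prod
      (r • ContinuousLinearMap.fst ℝ ℝ ℝ + s • ContinuousLinearMap.snd ℝ ℝ ℝ))
    (((p * s - q * r)⁻¹ • (s • ContinuousLinearMap.fst ℝ ℝ ℝ -
      q • ContinuousLinearMap.snd ℝ ℝ ℝ)).prod
      ((p * s - q * r)⁻¹ • (p • ContinuousLinearMap.snd ℝ ℝ ℝ -
        r • ContinuousLinearMap.fst ℝ ℝ ℝ)))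
    (fun z => by ext <;> simp <;> rw [inv_mul_eq_div, div_eq_iff h] <;> ring)
    (fun z => by ext <;> simp <;> rw [← mul_right_inj' h] <;> field_simp <;> ring)

theorem convex_charStrip (L : ℝ) : Convex ℝ (charStrip L) := by
  have h : IsLinearMap ℝ fun z : ℝ × ℝ => z.2 - z.1 :=
    ⟨fun x y => by simp; ring, fun c x => by simp; ring⟩
  exact (convex_halfSpace_gt h _).inter (convex_halfSpace_lt h _)

theorem exists_deriv_eq_zero_of_eq {f f' : ℝ → ℝ} (hf : ∀ s ∈ Icc (0 : ℝ) 1, HasDerivAt f (f' s) s)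
    (h : f 0 = f 1) : ∃ s ∈ Icc (0 : ℝ) 1, f' s = 0 := by
  obtain ⟨s, hs, h0⟩ := exists_hasDerivAt_eq_zero zero_lt_one
    (fun s hs => (hf s hs).continuousAt.continuousWithinAt) h
    fun s hs => hf s (Ioo_subset_Icc_self hs)
  exact ⟨s, Ioo_subset_Icc_self hs, h0⟩

namespace IsCharSol

variable {γ L T : ℝ} {t tq tp x u uq up v : ℝ → ℝ → ℝ}

/-- The map from characteristic coordinates to `(t, x)`. -/
def chart (t x : ℝ → ℝ → ℝ) (z : ℝ × ℝ) : ℝ × ℝ := (t z.1 z.2, x z.1 z.2)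

theorem cspeed_pos (h : IsCharSol γ L t tq tp x u uq up v) {a b : ℝ} (hz : (a, b) ∈ charStrip L) :
    0 < cspeed γ (u a b) :=
  rpow_pos_of_pos (h.u_pos a b hz) _

theorem contDiff_chart (h : IsCharSol γ L t tq tp x u uq up v) : ContDiff ℝ 1 (chart t x) :=
  h.contDiff_t.prodMk h.contDiff_x

theorem hasFDerivAt_t (h : IsCharSol γ L t tq tp x u uq up v) (a b : ℝ) :
    HasFDerivAt (uncurry t)
      (tq a b • ContinuousLinearMap.fst ℝ ℝ ℝ + tp a b • ContinuousLinearMap.snd ℝ ℝ ℝ) (a, b) :=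
  hasFDerivAt_uncurry (h.contDiff_t.differentiable one_ne_zero (a, b)) (h.t_left a b)
    (h.t_right a b)

theorem hasFDerivAt_x (h : IsCharSol γ L t tq tp x u uq up v) {a b : ℝ}
    (hz : (a, b) ∈ charStrip L) :
    HasFDerivAt (uncurry x) (-(cspeed γ (u a b) * tq a b) • ContinuousLinearMap.fst ℝ ℝ ℝ +
      (cspeed γ (u a b) * tp a b) • ContinuousLinearMap.snd ℝ ℝ ℝ) (a, b) :=
  hasFDerivAt_uncurry (h.contDiff_x.differentiable one_ne_zero (a, b)) (h.x_left a b hz)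
    (h.x_right a b hz)

theorem det_ne_zero (h : IsCharSol γ L t tq tp x u uq up v) {a b : ℝ}
    (hz : (a, b) ∈ charStrip L) :
    tq a b * (cspeed γ (u a b) * tp a b) - tp a b * -(cspeed γ (u a b) * tq a b) ≠ 0 := by
  have h1 := h.cspeed_pos hz
  have h2 := (h.tq_mem a b hz).2
  have h3 := (h.tp_mem a b hz).1
  have h4 : 0 < cspeed γ (u a b) * (-tq a b) * tp a b :=
    mul_pos (mul_pos h1 (by linarith)) (by linarith)
  intro h5
  linarith

theorem injOn_chart (h : IsCharSol γ L t tq tp x u uq up v) : InjOn (chart t x) (charStrip L) := by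
  rintro ⟨a, b⟩ hz ⟨a', b'⟩ hz' heq
  obtain ⟨ht, hx⟩ := Prod.ext_iff.1 heq
  simp only [chart] at ht hx
  have hseg : ∀ s ∈ Icc (0 : ℝ) 1, (a + s * (a' - a), b + s * (b' - b)) ∈ charStrip L := by
    intro s hs
    have := (convex_charStrip L).add_smul_sub_mem hz hz' hs
    simpa using this
  have hl : ∀ m n s : ℝ, HasDerivAt (fun s => m + s * (n - m)) (n - m) s := fun m n s => by
    simpa using ((hasDerivAt_id s).mul_const (n - m)).const_add m
  have key : ∀ m n : ℝ, 0 < m → 0 < n → 0 ≤ (a' - a) * (b' - b) →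
      m * (a' - a) + n * (b' - b) = 0 → a = a' ∧ b = b' := by
    intro m n hm hn h1 h2
    have h3 : n * (b' - b) ^ 2 = -(m * ((a' - a) * (b' - b))) := by
      linear_combination (b' - b) * h2
    have h4 : 0 ≤ m * ((a' - a) * (b' - b)) := by positivity
    have h5 : b' - b = 0 := by
      by_contra h6
      have : 0 < n * (b' - b) ^ 2 := by positivity
      linarith
    rw [h5, mul_zero, add_zero] at h2
    have h6 := (mul_eq_zero.1 h2).resolve_left hm.ne'
    exact ⟨by linarith, by linarith⟩
  have key' : a = a' ∧ b = b' := by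
    rcases le_total 0 ((a' - a) * (b' - b)) with h1 | h1
    · obtain ⟨s, hs, h0⟩ := exists_deriv_eq_zero_of_eq
        (f := fun s => x (a + s * (a' - a)) (b + s * (b' - b)))
        (fun s hs => hasDerivAt_along_curve (hl a a' s) (hl b b' s) (h.hasFDerivAt_x (hseg s hs)))
        (by simpa using hx)
      have hz'' := hseg s hs
      have hc := h.cspeed_pos hz''
      have hq := (h.tq_mem _ _ hz'').2
      have hp := (h.tp_mem _ _ hz'').1
      refine key _ _ (mul_pos hc (neg_pos.2 (by linarith :
        tq (a + s * (a' - a)) (b + s * (b' - b)) < 0))) (mul_pos hc (by linarith :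
        0 < tp (a + s * (a' - a)) (b + s * (b' - b)))) h1 ?_
      simp at h0
      linarith
    · obtain ⟨s, hs, h0⟩ := exists_deriv_eq_zero_of_eq
        (f := fun s => t (a + s * (a' - a)) (b + s * (b' - b)))
        (fun s _ => hasDerivAt_along_curve (hl a a' s) (hl b b' s) (h.hasFDerivAt_t _ _))
        (by simpa using ht)
      have hz'' := hseg s hs
      have hq := (h.tq_mem _ _ hz'').2
      have hp := (h.tp_mem _ _ hz'').1
      have h2 : 0 < -tq (a + s * (a' - a)) (b + s * (b' - b)) := by linarith
      have h3 : 0 < tp (a + s * (a' - a)) (b + s * (b' - b)) := by linarith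
      simp at h0
      generalize tq (a + s * (a' - a)) (b + s * (b' - b)) = m at *
      generalize tp (a + s * (a' - a)) (b + s * (b' - b)) = n at *
      have h4 : n * (b' - b) ^ 2 = (-m) * ((a' - a) * (b' - b)) := by
        linear_combination (b' - b) * h0
      have h5 : b' - b = 0 := by
        by_contra h6
        have : 0 < n * (b' - b) ^ 2 := by positivity
        nlinarith
      rw [h5, mul_zero, add_zero] at h0
      have h6 := (mul_eq_zero.1 h0).resolve_left (by linarith)
      exact ⟨by linarith, by linarith⟩
  exact Prod.ext key'.1 key'.2

theorem contDiffAt_chart_symm (h : IsCharSol γ L t tq tp x u uq up v) {a b : ℝ}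
    (hz : (a, b) ∈ charStrip L) :
    ContDiffAt ℝ 1 (invFunOn (chart t x) (charStrip L)) (t a b, x a b) :=
  contDiffAt_invFunOn (a := (a, b))
    (f' := linearEquivOfDet (tq a b) (tp a b) (-(cspeed γ (u a b) * tq a b))
      (cspeed γ (u a b) * tp a b) (h.det_ne_zero hz))
    (isOpen_charStrip L) h.injOn_chart hz h.contDiff_chart.contDiffAt
    ((h.hasFDerivAt_t a b).prodMk (h.hasFDerivAt_x hz))

/-- A function of the characteristic coordinates, as a function of `(t, x)`. -/
def push (L : ℝ) (t x f : ℝ → ℝ → ℝ) (s y : ℝ) : ℝ :=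
  uncurry f (invFunOn (chart t x) (charStrip L) (s, y))

theorem push_apply (h : IsCharSol γ L t tq tp x u uq up v) (f : ℝ → ℝ → ℝ) {a b : ℝ}
    (hz : (a, b) ∈ charStrip L) : push L t x f (t a b) (x a b) = f a b := by
  have := h.injOn_chart.leftInvOn_invFunOn hz
  simp only [chart] at this
  simp [push, this]

theorem contDiffAt_push (h : IsCharSol γ L t tq tp x u uq up v) {f : ℝ → ℝ → ℝ} {a b : ℝ}
    (hz : (a, b) ∈ charStrip L) (hf : ContDiffAt ℝ 1 (uncurry f) (a, b)) :
    ContDiffAt ℝ 1 (uncurry (push L t x f)) (t a b, x a b) := by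
  have h1 : invFunOn (chart t x) (charStrip L) (t a b, x a b) = (a, b) :=
    h.injOn_chart.leftInvOn_invFunOn hz
  exact ContDiffAt.comp (t a b, x a b) (by rwa [h1]) (h.contDiffAt_chart_symm hz)

theorem hasDerivAt_push (h : IsCharSol γ L t tq tp x u uq up v) {f : ℝ → ℝ → ℝ} {a b fq fp : ℝ}
    (hz : (a, b) ∈ charStrip L) (hf : ContDiffAt ℝ 1 (uncurry f) (a, b))
    (hq : HasDerivAt (fun s => f s b) fq a) (hp : HasDerivAt (fun s => f a s) fp b) :
    HasDerivAt (fun s => push L t x f s (x a b)) ((fp / tp a b + fq / tq a b) / 2) (t a b) ∧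
    HasDerivAt (fun y => push L t x f (t a b) y)
      ((fp / tp a b - fq / tq a b) / (2 * cspeed γ (u a b))) (x a b) := by
  have hd := (h.contDiffAt_push hz hf).differentiableAt one_ne_zero
  have h1 : HasDerivAt (fun s => push L t x f s (x a b))
      (fderiv ℝ (uncurry (push L t x f)) (t a b, x a b) (1, 0)) (t a b) :=
    hasDerivAt_along_curve (hasDerivAt_id' (t a b)) (hasDerivAt_const (t a b) (x a b))
      hd.hasFDerivAt
  have h2 : HasDerivAt (fun y => push L t x f (t a b) y)
      (fderiv ℝ (uncurry (push L t x f)) (t a b, x a b) (0, 1)) (x a b) :=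
    hasDerivAt_along_curve (hasDerivAt_const (x a b) (t a b)) (hasDerivAt_id' (x a b))
      hd.hasFDerivAt
  have hF := hasFDerivAt_uncurry hd h1 h2
  generalize fderiv ℝ (uncurry (push L t x f)) (t a b, x a b) (1, 0) = F₁ at h1 hF
  generalize fderiv ℝ (uncurry (push L t x f)) (t a b, x a b) (0, 1) = F₂ at h2 hF
  have hnhds := (isOpen_charStrip L).mem_nhds hz
  have e1 : ∀ᶠ s in 𝓝 a, (s, b) ∈ charStrip L :=
    (by fun_prop : Continuous fun s : ℝ => (s, b)).continuousAt.eventually hnhds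
  have e2 : ∀ᶠ s in 𝓝 b, (a, s) ∈ charStrip L :=
    (by fun_prop : Continuous fun s : ℝ => (a, s)).continuousAt.eventually hnhds
  have g1 := ((hasDerivAt_along_curve (h.t_left a b) (h.x_left a b hz) hF).congr_of_eventuallyEq
    (e1.mono fun s hs => (h.push_apply f hs).symm)).unique hq
  have g2 := ((hasDerivAt_along_curve (h.t_right a b) (h.x_right a b hz) hF).congr_of_eventuallyEq
    (e2.mono fun s hs => (h.push_apply f hs).symm)).unique hp
  have hc := h.cspeed_pos hz
  have hq0 : tq a b ≠ 0 := by linarith [(h.tq_mem a b hz).2]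
  have hp0 : tp a b ≠ 0 := by linarith [(h.tp_mem a b hz).1]
  simp at g1 g2
  rw [← g1, ← g2]
  constructor
  · convert h1 using 1
    field_simp; ring
  · convert h2 using 1
    field_simp; ring

theorem mem_charStrip_of_mem_Icc {a b s : ℝ} (h1 : (a, b) ∈ charStrip L) (h2 : s ∈ Icc a b) :
    (a, s) ∈ charStrip L := by
  obtain ⟨h3, h4⟩ := h1
  simp only at h3 h4
  constructor <;> simp only <;> linarith [h2.1, h2.2]

theorem quarter_mul_le (h : IsCharSol γ L t tq tp x u uq up v) {a b b' : ℝ} (hb : b ≤ b')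
    (hz : (a, b) ∈ charStrip L) (hz' : (a, b') ∈ charStrip L) :
    1 / 4 * (b' - b) ≤ t a b' - t a b := by
  refine (mul_le_sub_le_mul_of_hasDerivAt (M := 1) hb (fun s => h.t_right a s) (fun s hs => ?_)
    fun s hs => ?_).1
  all_goals
    have hs' : (a, s) ∈ charStrip L := by
      obtain ⟨h1, -⟩ := hz
      obtain ⟨-, h2⟩ := hz'
      simp only at h1 h2
      constructor <;> simp only <;> linarith [hs.1, hs.2]
  · exact (h.tp_mem a s hs').1
  · exact (h.tp_mem a s hs').2

theorem quarter_mul_abs_le (h : IsCharSol γ L t tq tp x u uq up v) {a b b' : ℝ}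
    (hz : (a, b) ∈ charStrip L) (hz' : (a, b') ∈ charStrip L) :
    1 / 4 * |b' - b| ≤ |t a b' - t a b| := by
  rcases le_total b b' with hb | hb
  · rw [abs_of_nonneg (sub_nonneg.2 hb)]
    exact (h.quarter_mul_le hb hz hz').trans (le_abs_self _)
  · rw [abs_sub_comm b', abs_sub_comm (t a b'), abs_of_nonneg (sub_nonneg.2 hb)]
    exact (h.quarter_mul_le hb hz' hz).trans (le_abs_self _)

theorem abs_sub_left_le (h : IsCharSol γ L t tq tp x u uq up v) {a a' b : ℝ}
    (hz : (a, b) ∈ charStrip L) (hz' : (a', b) ∈ charStrip L) :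
    |t a' b - t a b| ≤ |a' - a| := by
  have hmem : ∀ s ∈ uIcc a a', (s, b) ∈ charStrip L := fun s hs => by
    obtain ⟨h1, h2⟩ := hz
    obtain ⟨h3, h4⟩ := hz'
    simp only at h1 h2 h3 h4
    rw [mem_uIcc] at hs
    constructor <;> simp only <;> rcases hs with hs | hs <;> linarith [hs.1, hs.2]
  have := (convex_uIcc a a').norm_image_sub_le_of_norm_hasDerivWithin_le (C := 1)
    (fun s _ => (h.t_left s b).hasDerivWithinAt)
    (fun s hs => by
      have := h.tq_mem s b (hmem s hs)
      exact abs_le.2 ⟨this.1, by linarith [this.2]⟩) left_mem_uIcc right_mem_uIcc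
  simpa using this

theorem exists_time_eq (h : IsCharSol γ L t tq tp x u uq up v) (hL : 4 * T < L)
    (hdiag : ∀ s, t s s = 0) {r : ℝ} (hr : r ∈ Icc 0 T) (a : ℝ) :
    ∃ b ∈ Icc a (a + 4 * T), t a b = r := by
  have hT : 0 ≤ T := hr.1.trans hr.2
  have hz : (a, a) ∈ charStrip L := ⟨by simp only; linarith, by simp only; linarith⟩
  have hz' : (a, a + 4 * T) ∈ charStrip L := ⟨by simp only; linarith, by simp only; linarith⟩
  have h1 := h.quarter_mul_le (by linarith) hz hz'
  rw [hdiag] at h1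
  exact intermediate_value_Icc (by linarith)
    (fun s _ => (h.t_right a s).continuousAt.continuousWithinAt)
    ⟨by rw [hdiag]; exact hr.1, by linarith [hr.2]⟩

theorem surjOn_chart (h : IsCharSol γ L t tq tp x u uq up v) (hL : 4 * T < L)
    (hdiag : ∀ s, t s s = 0 ∧ x s s = s) : SurjOn (chart t x) (charStrip L) (strip T) := by
  rintro ⟨r, y⟩ ⟨hr, -⟩
  simp only at hr
  have hT : 0 ≤ T := hr.1.trans hr.2
  choose β hβ htβ using h.exists_time_eq hL (fun s => (hdiag s).1) hr
  have hmem : ∀ a, (a, β a) ∈ charStrip L := fun a =>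
    ⟨by simp only; linarith [(hβ a).1], by simp only; linarith [(hβ a).2]⟩
  have hβc : Continuous β := by
    rw [Metric.continuous_iff]
    intro a ε hε
    refine ⟨min (ε / 4) (min (1 / 4) (L - 4 * T)), by
      have : 0 < L - 4 * T := by linarith
      positivity, fun a' ha' => ?_⟩
    rw [Real.dist_eq] at ha' ⊢
    obtain ⟨h1, h2⟩ := lt_min_iff.1 ha'
    obtain ⟨h3, h4⟩ := lt_min_iff.1 h2
    have hz : (a', β a) ∈ charStrip L :=
      ⟨by simp only; linarith [(hβ a).1, (abs_lt.1 h3).2],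
        by simp only; linarith [(hβ a).2, (abs_lt.1 h4).1]⟩
    have h5 := h.quarter_mul_abs_le hz (hmem a')
    have h6 := h.abs_sub_left_le (hmem a) hz
    rw [htβ] at h5 h6
    rw [abs_sub_comm r] at h5
    linarith
  obtain ⟨M, hM⟩ := h.bdd
  have hX : ∀ a, |x a (β a) - a| ≤ |M| * (4 * T) := by
    intro a
    have := (convex_Icc a (β a)).norm_image_sub_le_of_norm_hasDerivWithin_le (C := |M|)
      (f := fun s => x a s) (f' := fun s => cspeed γ (u a s) * tp a s)
      (fun s hs => (h.x_right a s (mem_charStrip_of_mem_Icc (hmem a) hs)).hasDerivWithinAt)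
      (fun s hs => by
        have hs' := mem_charStrip_of_mem_Icc (hmem a) hs
        have h1 := h.tp_mem a s hs'
        have h2 := h.cspeed_pos hs'
        rw [Real.norm_eq_abs, abs_of_pos (mul_pos h2 (by linarith [h1.1]))]
        have h3 := (hM a s hs').2.2.2.2.1.trans (le_abs_self M)
        nlinarith [h1.1, h1.2]) (left_mem_Icc.2 (hβ a).1) (right_mem_Icc.2 (hβ a).1)
    simp only [(hdiag a).2, Real.norm_eq_abs] at this
    rw [abs_of_nonneg (sub_nonneg.2 (hβ a).1)] at this
    refine this.trans (mul_le_mul_of_nonneg_left ?_ (abs_nonneg M))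
    linarith [(hβ a).2]
  have hXc : Continuous fun a => x a (β a) :=
    h.contDiff_x.continuous.comp (continuous_id.prodMk hβc)
  have hK : 0 ≤ |M| * (4 * T) := by positivity
  obtain ⟨a, -, ha⟩ := intermediate_value_Icc
    (by linarith : y - |M| * (4 * T) ≤ y + |M| * (4 * T)) hXc.continuousOn
    (show y ∈ Icc _ _ from ⟨by linarith [(abs_le.1 (hX (y - |M| * (4 * T)))).2],
      by linarith [(abs_le.1 (hX (y + |M| * (4 * T)))).1]⟩)
  exact ⟨(a, β a), hmem a, Prod.ext (htβ a) ha⟩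

theorem isC1On_push (h : IsCharSol γ L t tq tp x u uq up v)
    (hsurj : SurjOn (chart t x) (charStrip L) (strip T)) {f : ℝ → ℝ → ℝ}
    (hf : ∀ a b, (a, b) ∈ charStrip L → ContDiffAt ℝ 1 (uncurry f) (a, b)) :
    IsC1On (push L t x f) (strip T) := by
  intro p hp
  obtain ⟨⟨a, b⟩, hz, rfl⟩ := hsurj hp
  exact (h.contDiffAt_push hz (hf a b hz)).contDiffWithinAt

theorem hasDerivAt_pres {γ u₀ u' s : ℝ} {f : ℝ → ℝ} (hγ : 1 < γ) (hf : HasDerivAt f u' s)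
    (hu : f s = u₀) (hu₀ : 0 < u₀) :
    HasDerivAt (fun s => pres γ (f s)) (-(cspeed γ u₀ ^ 2 * u')) s := by
  have h1 : HasDerivAt (fun s => pres γ (f s)) _ s :=
    (hf.rpow_const (p := -γ) (Or.inl (by rw [hu]; exact hu₀.ne'))).div_const γ
  convert h1 using 1
  rw [cspeed, hu, ← rpow_natCast, ← rpow_mul hu₀.le, show -γ - 1 = -(γ + 1) / 2 * (2 : ℕ) by
    push_cast; ring]
  field_simp

theorem exists_euler (h : IsCharSol γ L t tq tp x u uq up v) (hγ : 1 < γ) (hL0 : 0 < L)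
    (hL : 4 * T < L) (hdiag : ∀ s, t s s = 0 ∧ x s s = s) :
    ∃ u' v' : ℝ → ℝ → ℝ, IsC1bOn u' (strip T) ∧ IsC1bOn v' (strip T) ∧
      IsEulerOn γ 2 1 u' v' (strip T) ∧ (∀ y, u' 0 y = u y y ∧ v' 0 y = v y y) ∧
      ∀ p ∈ strip T, 0 < u' p.1 p.2 := by
  have hsurj := h.surjOn_chart hL hdiag
  obtain ⟨M, hM⟩ := h.bdd
  have key : ∀ p ∈ strip T, ∃ a b, (a, b) ∈ charStrip L ∧ p = (t a b, x a b) ∧ ∃ P Q,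
      |P| ≤ 4 * M ∧ |Q| ≤ 4 * M ∧
      HasDerivAt (fun s => push L t x u s p.2) ((P + Q) / 2) p.1 ∧
      HasDerivAt (fun y => push L t x u p.1 y) ((P - Q) / (2 * cspeed γ (u a b))) p.2 ∧
      HasDerivAt (fun s => push L t x v s p.2)
        (cspeed γ (u a b) * ((P - Q) / 2) - 2 * v a b / (1 + t a b)) p.1 ∧
      HasDerivAt (fun y => push L t x v p.1 y) ((P + Q) / 2) p.2 := by
    intro p hp
    obtain ⟨⟨a, b⟩, hz, rfl⟩ := hsurj hp
    have hc := h.cspeed_pos hz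
    have hq := h.tq_mem a b hz
    have hp' := h.tp_mem a b hz
    have hq0 : tq a b ≠ 0 := by linarith [hq.2]
    have hp0 : tp a b ≠ 0 := by linarith [hp'.1]
    have h1 := h.hasDerivAt_push hz (h.contDiffAt_u a b hz) (h.u_left a b hz) (h.u_right a b hz)
    have h2 := h.hasDerivAt_push hz (h.contDiffAt_v a b hz) (h.v_left a b hz) (h.v_right a b hz)
    obtain ⟨hM1, hM2, hM3, hM4, -⟩ := hM a b hz
    have hM0 : 0 ≤ M := (abs_nonneg _).trans hM1
    have ht0 : 1 + t a b ≠ 0 := by linarith [h.t_ge a b hz]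
    refine ⟨a, b, hz, rfl, up a b / tp a b, uq a b / tq a b, ?_, ?_, h1.1, h1.2, ?_, ?_⟩
    · have h0 : 0 < tp a b := by linarith [hp'.1]
      rw [abs_div, abs_of_pos h0, div_le_iff₀ h0]
      nlinarith [hp'.1]
    · have h0 : tq a b < 0 := by linarith [hq.2]
      rw [abs_div, abs_of_neg h0, div_le_iff₀ (neg_pos.2 h0)]
      nlinarith [hq.2]
    · refine h2.1.congr_deriv ?_
      field_simp
      ring
    · refine h2.2.congr_deriv ?_
      field_simp
      ring
  refine ⟨push L t x u, push L t x v, ⟨h.isC1On_push hsurj h.contDiffAt_u,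
    M + 4 * M + |M| * (4 * M), ?_⟩, ⟨h.isC1On_push hsurj h.contDiffAt_v,
    M + (|M| * (4 * M) + 4 * M) + 4 * M, ?_⟩, ?_, fun y => ?_, ?_⟩
  · intro p hp
    obtain ⟨a, b, hz, rfl, P, Q, hP, hQ, h1, h2, h3, h4⟩ := key p hp
    obtain ⟨hM1, hM2, -, -, hM5, hM6⟩ := hM a b hz
    have hM0 : 0 ≤ M := (abs_nonneg _).trans hM1
    have hc := h.cspeed_pos hz
    simp only [pdt, pdx]
    rw [h1.deriv, h2.deriv, h.push_apply u hz, show (P - Q) / (2 * cspeed γ (u a b)) =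
      (cspeed γ (u a b))⁻¹ * ((P - Q) / 2) by field_simp]
    rw [abs_mul, abs_of_pos (inv_pos.2 hc)]
    have h5 : |(P + Q) / 2| ≤ 4 * M := abs_le.2
      ⟨by linarith [(abs_le.1 hP).1, (abs_le.1 hQ).1],
        by linarith [(abs_le.1 hP).2, (abs_le.1 hQ).2]⟩
    have h6 : |(P - Q) / 2| ≤ 4 * M := abs_le.2
      ⟨by linarith [(abs_le.1 hP).1, (abs_le.1 hQ).2],
        by linarith [(abs_le.1 hP).2, (abs_le.1 hQ).1]⟩
    have h7 := mul_le_mul (hM6.trans (le_abs_self M)) h6 (abs_nonneg _) (abs_nonneg _)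
    linarith
  · intro p hp
    obtain ⟨a, b, hz, rfl, P, Q, hP, hQ, h1, h2, h3, h4⟩ := key p hp
    obtain ⟨hM1, hM2, -, -, hM5, hM6⟩ := hM a b hz
    have hM0 : 0 ≤ M := (abs_nonneg _).trans hM1
    have hc := h.cspeed_pos hz
    have ht := h.t_ge a b hz
    simp only [pdt, pdx]
    rw [h3.deriv, h4.deriv, h.push_apply v hz]
    have h5 : |(P + Q) / 2| ≤ 4 * M := abs_le.2
      ⟨by linarith [(abs_le.1 hP).1, (abs_le.1 hQ).1],
        by linarith [(abs_le.1 hP).2, (abs_le.1 hQ).2]⟩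
    have h6 : |(P - Q) / 2| ≤ 4 * M := abs_le.2
      ⟨by linarith [(abs_le.1 hP).1, (abs_le.1 hQ).2],
        by linarith [(abs_le.1 hP).2, (abs_le.1 hQ).1]⟩
    have h7 := mul_le_mul (hM5.trans (le_abs_self M)) h6 (abs_nonneg _) (abs_nonneg _)
    have h8 := abs_sub (cspeed γ (u a b) * ((P - Q) / 2)) (2 * v a b / (1 + t a b))
    rw [abs_mul, abs_of_pos hc] at h8
    have h9 : |2 * v a b / (1 + t a b)| ≤ 4 * M := by
      rw [abs_div, abs_of_pos (by linarith : 0 < 1 + t a b), div_le_iff₀ (by linarith), abs_mul,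
        abs_two]
      nlinarith
    linarith
  · intro p hp
    obtain ⟨a, b, hz, rfl, P, Q, hP, hQ, h1, h2, h3, h4⟩ := key p hp
    have hc := h.cspeed_pos hz
    simp only [pdt, pdx] at h1 h2 h3 h4 ⊢
    rw [h1.deriv, h4.deriv, h3.deriv, (hasDerivAt_pres hγ h2 (h.push_apply u hz)
      (h.u_pos a b hz)).deriv, h.push_apply v hz, rpow_one]
    refine ⟨sub_self _, ?_⟩
    have := h.t_ge a b hz
    have h0 : 1 + t a b ≠ 0 := by linarith
    field_simp
    ring
  · have hz : (y, y) ∈ charStrip L := ⟨by simp only; linarith, by simp only; linarith⟩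
    have h1 := h.push_apply u hz
    have h2 := h.push_apply v hz
    rw [(hdiag y).1, (hdiag y).2] at h1 h2
    exact ⟨h1, h2⟩
  · intro p hp
    obtain ⟨⟨a, b⟩, hz, rfl⟩ := hsurj hp
    exact (h.push_apply u hz).symm ▸ h.u_pos a b hz

end IsCharSol

theorem arsinh_four_mul_exp_add_one_le {s : ℝ} (hs : 0 ≤ s) :
    arsinh (4 * exp s + 1) ≤ 11 + s := by
  have h1 : 1 ≤ exp s := one_le_exp hs
  have h2 : √(1 + (4 * exp s + 1) ^ 2) ≤ 4 * exp s + 2 := by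
    rw [sqrt_le_left (by positivity)]
    nlinarith
  calc arsinh (4 * exp s + 1) ≤ log (11 * exp s) := log_le_log (by positivity) (by linarith)
    _ = log 11 + s := by rw [log_mul (by norm_num) (exp_pos s).ne', log_exp]
    _ ≤ 11 + s := by linarith [log_le_self (show (0 : ℝ) ≤ 11 by norm_num)]

/-- The potential `2 / (γ - 1) * (1 - y ^ (-(γ - 1) / 2))`, inverse to `volumeOf γ`. -/
def potential (γ y : ℝ) : ℝ := 2 / (γ - 1) * (1 - y ^ (-(γ - 1) / 2))

theorem one_sub_potential {γ : ℝ} (hγ : 1 < γ) (y : ℝ) :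
    1 - (γ - 1) / 2 * potential γ y = y ^ (-(γ - 1) / 2) := by
  have : γ - 1 ≠ 0 := by linarith
  rw [potential]
  field_simp
  ring

theorem volumeOf_potential {γ y : ℝ} (hγ : 1 < γ) (hy : 0 < y) :
    volumeOf γ (potential γ y) = y := by
  have : γ - 1 ≠ 0 := by linarith
  rw [volumeOf, one_sub_potential hγ, ← rpow_mul hy.le,
    show -(γ - 1) / 2 * (-2 / (γ - 1)) = 1 by field_simp, rpow_one]

theorem soundOf_potential {γ y : ℝ} (hγ : 1 < γ) (hy : 0 < y) :
    soundOf γ (potential γ y) = cspeed γ y := by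
  rw [← cspeed_volumeOf hγ (by rw [one_sub_potential hγ]; exact rpow_pos_of_pos hy _),
    volumeOf_potential hγ hy]

theorem hasDerivAt_potential {γ y : ℝ} (hγ : 1 < γ) (hy : 0 < y) :
    HasDerivAt (potential γ) (y ^ (-(γ + 1) / 2)) y := by
  have : γ - 1 ≠ 0 := by linarith
  have h : HasDerivAt (potential γ) _ y :=
    ((hasDerivAt_rpow_const (p := -(γ - 1) / 2) (Or.inl hy.ne')).const_sub 1).const_mul
      (2 / (γ - 1))
  refine h.congr_deriv ?_
  rw [show -(γ - 1) / 2 - 1 = -(γ + 1) / 2 by ring]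
  field_simp

theorem exists_potential_bound {γ : ℝ} (hγ : 1 < γ) :
    ∃ B, 0 ≤ B ∧ ∀ y ∈ Icc (1 / 2 : ℝ) (3 / 2),
      |y ^ (-(γ + 1) / 2)| ≤ B ∧ |potential γ y| ≤ B * |y - 1| := by
  obtain ⟨B, hB, h⟩ := exists_rpow_bound (-(γ + 1) / 2)
  refine ⟨B, hB, fun y hy => ⟨h y hy, ?_⟩⟩
  have h1 := (convex_Icc (1 / 2 : ℝ) (3 / 2)).norm_image_sub_le_of_norm_hasDerivWithin_le (C := B)
    (f := potential γ) (fun s hs => (hasDerivAt_potential hγ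
      (by linarith [hs.1] : 0 < s)).hasDerivWithinAt) (fun s hs => h s hs)
    (by constructor <;> norm_num : (1 : ℝ) ∈ _) hy
  have h2 : potential γ 1 = 0 := by simp [potential]
  simpa only [h2, sub_zero, Real.norm_eq_abs] using h1

theorem exists_cspeed_mem {γ : ℝ} :
    ∃ δ > 0, ∀ y : ℝ, |y - 1| < δ → cspeed γ y ∈ Icc (2 / 3) (4 / 3) := by
  have h : ContinuousAt (cspeed γ) 1 := continuousAt_rpow_const 1 _ (Or.inl one_ne_zero)
  obtain ⟨δ, hδ, h'⟩ := Metric.continuousAt_iff.1 h (1 / 3) (by norm_num)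
  refine ⟨δ, hδ, fun y hy => ?_⟩
  have := abs_lt.1 (h' (x := y) hy)
  simp only [cspeed, one_rpow] at this ⊢
  constructor <;> linarith [this.1, this.2]

theorem IsC1b.exists_bound {f : ℝ → ℝ} (hf : IsC1b f) :
    ∃ M, ∀ x, |f x| ≤ M ∧ |deriv f x| ≤ M := by
  obtain ⟨M, hM⟩ := hf.2
  exact ⟨M, fun x => ⟨by linarith [hM x, abs_nonneg (deriv f x)],
    by linarith [hM x, abs_nonneg (f x)]⟩⟩

/-- For `μ = 1` and `λ = 2`, the lifespan satisfies
`T* ≥ exp(C/ε)`. -/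
theorem lifespan_lower_bound_mu_one_lam_two
    (γ : ℝ) (φ ψ : ℝ → ℝ) (hγ : 1 < γ)
    (hφ : IsC1b φ) (hψ : IsC1b ψ) :
    ∃ ε₀ > 0, ∃ C > 0, ∀ ε : ℝ, 0 < ε → ε ≤ ε₀ →
      ∃ u v : ℝ → ℝ → ℝ,
        IsC1bOn u (strip (Real.exp (C / ε))) ∧
        IsC1bOn v (strip (Real.exp (C / ε))) ∧
        IsEulerOn γ 2 1 u v (strip (Real.exp (C / ε))) ∧
        (∀ x, u 0 x = 1 + ε * φ x ∧ v 0 x = ε * ψ x) ∧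
        (∀ p ∈ strip (Real.exp (C / ε)), 0 < u p.1 p.2) := by
  obtain ⟨M₁, hM₁⟩ := hφ.exists_bound
  obtain ⟨M₂, hM₂⟩ := hψ.exists_bound
  obtain ⟨B, hB0, hB⟩ := exists_potential_bound hγ
  obtain ⟨δ, hδ, hcs⟩ := exists_cspeed_mem (γ := γ)
  obtain ⟨M, hM0, hM1, hM2⟩ : ∃ M, 0 < M ∧ M₁ ≤ M ∧ M₂ ≤ M :=
    ⟨max 1 (max M₁ M₂), by positivity, by simp, by simp⟩
  have hγ0 : 0 < γ - 1 := by linarith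
  have hγ1 : 0 < γ + 1 := by linarith
  set K := 32 * (B + 1) * M with hK
  have hK0 : 0 < K := by positivity
  set C := 1 / (256 * (γ + 1) * K) with hC
  have hC0 : 0 < C := by positivity
  refine ⟨min (min (1 / (2 * M)) (δ / (2 * M))) (min (1 / ((γ - 1) * K)) (C / 11)),
    by positivity, C, hC0, fun ε hε hle => ?_⟩
  obtain ⟨⟨h1, h2⟩, h3, h4⟩ : (ε ≤ 1 / (2 * M) ∧ ε ≤ δ / (2 * M)) ∧
      ε ≤ 1 / ((γ - 1) * K) ∧ ε ≤ C / 11 := by simpa only [le_min_iff] using hle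
  rw [le_div_iff₀ (by positivity)] at h1 h2 h3 h4
  have hφε : ∀ x, |ε * φ x| ≤ ε * M ∧ |ε * deriv φ x| ≤ ε * M := fun x => by
    rw [abs_mul, abs_mul, abs_of_pos hε]
    exact ⟨mul_le_mul_of_nonneg_left ((hM₁ x).1.trans hM1) hε.le,
      mul_le_mul_of_nonneg_left ((hM₁ x).2.trans hM1) hε.le⟩
  have hψε : ∀ x, |ε * ψ x| ≤ ε * M ∧ |ε * deriv ψ x| ≤ ε * M := fun x => by
    rw [abs_mul, abs_mul, abs_of_pos hε]
    exact ⟨mul_le_mul_of_nonneg_left ((hM₂ x).1.trans hM2) hε.le,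
      mul_le_mul_of_nonneg_left ((hM₂ x).2.trans hM2) hε.le⟩
  have hεM : 0 < ε * M := by positivity
  have hy : ∀ x, 1 + ε * φ x ∈ Icc (1 / 2 : ℝ) (3 / 2) := fun x => by
    have := abs_le.1 (hφε x).1
    constructor <;> linarith [this.1, this.2]
  have hy0 : ∀ x, 0 < 1 + ε * φ x := fun x => by linarith [(hy x).1]
  have hφd : ∀ x, HasDerivAt (fun x => 1 + ε * φ x) (ε * deriv φ x) x := fun x =>
    (((hφ.1.differentiable one_ne_zero x).hasDerivAt).const_mul ε).const_add 1
  have hψd : ∀ x, HasDerivAt (fun x => ε * ψ x) (ε * deriv ψ x) x := fun x =>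
    ((hψ.1.differentiable one_ne_zero x).hasDerivAt).const_mul ε
  have hφc : Continuous (deriv φ) := hφ.1.continuous_deriv le_rfl
  have hψc : Continuous (deriv ψ) := hψ.1.continuous_deriv le_rfl
  have hφc' := hφ.1.continuous
  have hT : 0 < exp (C / ε) := exp_pos _
  have hsmall : 16 * (γ + 1) * (K * ε) * arsinh (4 * exp (C / ε) + 1) ≤ 1 / 8 := by
    have h5 := mul_le_mul_of_nonneg_left (arsinh_four_mul_exp_add_one_le (by positivity :
      0 ≤ C / ε)) (by positivity : 0 ≤ 16 * (γ + 1) * (K * ε))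
    refine h5.trans ?_
    have h6 : 16 * (γ + 1) * (K * ε) * (11 + C / ε) = 16 * (γ + 1) * K * (ε * 11 + C) := by
      field_simp
    have h7 : 16 * (γ + 1) * K * (C + C) = 1 / 8 := by
      rw [hC]; field_simp; norm_num
    rw [h6, ← h7]
    gcongr
  obtain ⟨t, tq, tp, x, u, uq, up, v, hsol, hdiag⟩ := exists_isCharSol (γ := γ) (κ := K * ε)
    (L := 4 * exp (C / ε) + 1) (η₀ := fun x => potential γ (1 + ε * φ x))
    (e₁ := fun x => (1 + ε * φ x) ^ (-(γ + 1) / 2) * (ε * deriv φ x))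
    (v₀ := fun x => ε * ψ x) (w := fun x => ε * deriv ψ x) hγ (by positivity) (by linarith)
    (by linarith) hsmall
    ((Continuous.rpow_const (by fun_prop) fun x => Or.inl (hy0 x).ne').mul (by fun_prop))
    (by fun_prop) (fun s => HasDerivAt.comp (h₂ := potential γ) s
      (hasDerivAt_potential hγ (hy0 s)) (hφd s)) hψd
    (fun s => by
      refine (hB _ (hy s)).2.trans ?_
      rw [add_sub_cancel_left]
      have := mul_le_mul_of_nonneg_left (hφε s).1 hB0
      rw [hK]
      linarith)
    (fun s => by
      rw [abs_mul]
      have := mul_le_mul (hB _ (hy s)).1 (hφε s).2 (abs_nonneg _) hB0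
      rw [hK]
      linarith)
    (fun s => (hψε s).1.trans (by rw [hK]; nlinarith))
    (fun s => (hψε s).2.trans (by rw [hK]; nlinarith))
    (fun s => by
      rw [soundOf_potential hγ (hy0 s)]
      refine hcs _ ?_
      rw [add_sub_cancel_left]
      linarith [(hφε s).1])
  obtain ⟨u', v', hu', hv', heuler, hinit, hpos⟩ := hsol.exists_euler (T := exp (C / ε)) hγ
    (by positivity) (by linarith) fun s => ⟨(hdiag s).1, (hdiag s).2.1⟩
  refine ⟨u', v', hu', hv', heuler, fun y => ?_, hpos⟩
  rw [(hinit y).1, (hinit y).2, (hdiag y).2.2.1, (hdiag y).2.2.2, volumeOf_potential hγ (hy0 y)]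
  exact ⟨rfl, rfl⟩
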